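/- arXiv:math/0201265 — 4 statements merged into one kernel-verified Lean document; each statement's English description precedes it below -/
import Mathlib

section
/- Define t_n = 1 if 5 ∤ τ(n) and t_n = 0 otherwise, and let T(s) = ∑_{n=1}^∞ t_n·n^{-s}. Let χ_c be the Dirichlet character modulo 5 determined by χ_c(2) = i, and χ₅ the Dirichlet character modulo 5 determined by χ₅(2) = −1. Let H(s) = ∏_{p ≡ 1 (mod 5)} ((1 − p^{-4s})/(1 − p^{-5s}))^4 · ∏_{p ≡ ±2 (mod 5)} (1 − p^{-3s})^4/((1 − p^{-2s})^2·(1 − p^{-4s})^3) · ∏_{p ≡ 4 (mod 5)} (1 − p^{-2s})^{-2}, products over primes. Then for real s > 1, T(s)^4 = (1 − 5^{-s})^3 · H(s) · ζ(s)^3 · L(s,χ_c)·L(s,χ̄_c)/L(s,χ₅). -/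
open Finset

/-- Ramanujan's tau function, defined by
`q ∏_{n≥1} (1 - q^n)^24 = ∑_{n≥1} τ(n) q^n`; the coefficient of `q^n` only
involves the factors with index at most `n`. -/
noncomputable def ramanujanTau (n : ℕ) : ℤ :=
  (Polynomial.X * ∏ k ∈ Finset.Icc 1 n, ((1 : Polynomial ℤ) - Polynomial.X ^ k) ^ 24).coeff n

/-- `t n = 1` if `5 ∤ τ(n)`, and `t n = 0` otherwise. -/
noncomputable def t5 (n : ℕ) : ℝ := if (5 : ℤ) ∣ ramanujanTau n then 0 else 1

/-- The auxiliary Euler product `H(s)` of the `5 ∤ τ(n)` case. -/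
noncomputable def H5 (s : ℝ) : ℝ :=
  (∏' p : {p : ℕ // p.Prime ∧ p % 5 = 1},
      ((1 - (p.1 : ℝ) ^ (-(4 * s))) / (1 - (p.1 : ℝ) ^ (-(5 * s)))) ^ 4)
    * (∏' p : {p : ℕ // p.Prime ∧ (p % 5 = 2 ∨ p % 5 = 3)},
        (1 - (p.1 : ℝ) ^ (-(3 * s))) ^ 4
          / ((1 - (p.1 : ℝ) ^ (-(2 * s))) ^ 2 * (1 - (p.1 : ℝ) ^ (-(4 * s))) ^ 3))
    * (∏' p : {p : ℕ // p.Prime ∧ p % 5 = 4},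
        ((1 - (p.1 : ℝ) ^ (-(2 * s))) ^ 2)⁻¹)

section partA
open UpperHalfPlane ModularForm ModularFormClass MatrixGroups EisensteinSeries Derivative Complex Function SlashInvariantForm
open scoped Manifold Topology Real

/-- `f` has the `q`-expansion `P`. -/
def PSx (f : ℍ → ℂ) (P : PowerSeries ℂ) : Prop :=
  ∀ τ : ℍ, HasSum (fun m : ℕ ↦ P.coeff m • Periodic.qParam 1 τ ^ m) (f τ)

lemma PSx.add {f g : ℍ → ℂ} {P Q : PowerSeries ℂ} (hf : PSx f P) (hg : PSx g Q) :
    PSx (f + g) (P + Q) := fun τ ↦ by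
  simpa [add_mul] using (hf τ).add (hg τ)

lemma PSx.smul {f : ℍ → ℂ} {P : PowerSeries ℂ} (c : ℂ) (hf : PSx f P) :
    PSx (c • f) (c • P) := fun τ ↦ by
  simpa [mul_assoc] using (hf τ).mul_left c

lemma PSx.mul {f g : ℍ → ℂ} {P Q : PowerSeries ℂ} (hf : PSx f P) (hg : PSx g Q) :
    PSx (f * g) (P * Q) := by
  intro τ
  have h1 := (hf τ).summable.norm
  have h2 := (hg τ).summable.norm
  have h3 := (summable_norm_sum_mul_antidiagonal_of_summable_norm h1 h2).of_norm.hasSum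
  rw [← tsum_mul_tsum_eq_tsum_sum_antidiagonal_of_summable_norm h1 h2, (hf τ).tsum_eq,
    (hg τ).tsum_eq] at h3
  suffices e : (fun m : ℕ ↦ (P * Q).coeff m • Periodic.qParam 1 τ ^ m) = fun n ↦
      ∑ kl ∈ Finset.HasAntidiagonal.antidiagonal n, (P.coeff kl.1 • Periodic.qParam 1 (τ:ℂ) ^ kl.1) *
        (Q.coeff kl.2 • Periodic.qParam 1 (τ:ℂ) ^ kl.2) by
    rw [e]; exact h3
  ext m
  rw [PowerSeries.coeff_mul, smul_eq_mul, Finset.sum_mul]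
  refine Finset.sum_congr rfl fun x hx ↦ ?_
  rw [← Finset.HasAntidiagonal.mem_antidiagonal.1 hx, pow_add]
  simp only [smul_eq_mul]; ring

lemma PSx.of_modular {k : ℤ} (f : ModularForm 𝒮ℒ k) : PSx f (qExpansion 1 f) := fun τ ↦
  UpperHalfPlane.hasSum_qExpansion one_pos (SlashInvariantFormClass.periodic_comp_ofComplex f one_mem_strictPeriods_SL)
    (holo f) (bdd_at_infty f) τ

lemma PSx.unique {k : ℤ} (f : ModularForm 𝒮ℒ k) {P : PowerSeries ℂ} (h : PSx f P) :
    qExpansion 1 f = P := by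
  ext m
  exact (ModularFormClass.qExpansion_coeff_unique one_pos one_mem_strictPeriods_SL h m).symm

lemma PSx_D {k : ℤ} (f : ModularForm 𝒮ℒ k) :
    PSx (normalizedDerivOfComplex f)
      (PowerSeries.mk fun m ↦ m * (qExpansion 1 f).coeff m) := by
  intro τ
  have hper := SlashInvariantFormClass.periodic_comp_ofComplex f one_mem_strictPeriods_SL
  set c := cuspFunction 1 f with hc
  have hd : DifferentiableOn ℂ c (Metric.ball 0 1) :=
    differentiableOn_cuspFunction_ball one_pos hper (holo f) (bdd_at_infty f)
  set q := Periodic.qParam 1 τ with hq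
  have hq1 : ‖q‖ < 1 := Periodic.norm_qParam_lt_one one_pos τ.im_pos
  have hqm : q ∈ Metric.ball (0:ℂ) 1 := by simpa using hq1
  have h1 := hasSum_taylorSeries_on_ball (hd.deriv Metric.isOpen_ball) hqm
  have hder : normalizedDerivOfComplex f τ = q * deriv c q := by
    have e : (f ∘ ofComplex) =ᶠ[𝓝 (τ : ℂ)] fun z ↦ c (Periodic.qParam 1 z) := by
      filter_upwards [isOpen_upperHalfPlaneSet.mem_nhds τ.im_pos] with z hz
      have := Periodic.eq_cuspFunction (one_ne_zero) hper z
      exact this.symm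
    have hqd : HasDerivAt (fun z : ℂ ↦ Periodic.qParam 1 z) (q * (2 * π * Complex.I)) (τ : ℂ) := by
      have : HasDerivAt (fun z : ℂ ↦ cexp (2 * π * Complex.I * z / (1:ℝ))) (cexp (2 * π * Complex.I * τ / (1:ℝ)) * (2 * π * Complex.I * 1 / (1:ℝ))) (τ : ℂ) :=
        (((hasDerivAt_id (τ : ℂ)).const_mul (2 * π * Complex.I)).div_const _).cexp
      simpa [Periodic.qParam, hq] using this
    have hcd : HasDerivAt c (deriv c q) (Periodic.qParam 1 (τ:ℂ)) :=
      (hd.differentiableAt (Metric.isOpen_ball.mem_nhds hqm)).hasDerivAt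
    have := hcd.comp (τ : ℂ) hqd
    rw [normalizedDerivOfComplex, e.deriv_eq]
    have e2 := this.deriv
    simp only [Function.comp_def] at e2
    rw [e2]
    have : (π : ℂ) ≠ 0 := by simp
    field_simp [Complex.I_ne_zero]
  rw [hder, ← hasSum_nat_add_iff' 1]
  have e1 : q * deriv c q - ∑ i ∈ Finset.range 1, (PowerSeries.mk fun m ↦
      (m:ℂ) * (qExpansion 1 f).coeff m).coeff i • q ^ i = q * deriv c q := by simp
  have e2 : (fun n : ℕ ↦ (PowerSeries.mk fun m ↦ (m:ℂ) * (qExpansion 1 f).coeff m).coeff (n+1)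
      • q ^ (n+1)) = fun n ↦ q * ((n.factorial : ℂ)⁻¹ • (q - 0) ^ n • iteratedDeriv n (deriv c) 0) := by
    ext m
    simp only [PowerSeries.coeff_mk, smul_eq_mul, UpperHalfPlane.qExpansion_coeff, ← hc, sub_zero,
      ← iteratedDeriv_succ']
    rw [Nat.factorial_succ]
    have : ((m+1 : ℕ) : ℂ) ≠ 0 := by exact_mod_cast Nat.succ_ne_zero m
    have : (m.factorial : ℂ) ≠ 0 := by exact_mod_cast Nat.factorial_ne_zero m
    push_cast at *
    field_simp
    ring
  rw [e1, e2]
  exact h1.mul_left q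

/-- q-expansion of `E2`. -/
noncomputable def QE2 : PowerSeries ℂ := PowerSeries.mk fun m ↦ if m = 0 then 1 else -24 * (ArithmeticFunction.sigma 1 m : ℂ)

lemma PSx_E2 : PSx E2 QE2 := fun τ ↦ by
  simpa [QE2, Periodic.qParam] using hasSum_qExpansion_E2 (z := τ)

lemma PSx_serre : PSx (serreDerivative ((6:ℤ):ℂ) E₆) ((PowerSeries.mk fun m ↦ m * (qExpansion 1 E₆).coeff m) + (-(1/2) : ℂ) • (QE2 * qExpansion 1 E₆)) := by
  have := (PSx_D E₆).add ((PSx_E2.mul (PSx.of_modular E₆)).smul (-(1/2)))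
  convert this using 1
  ext z
  simp [serreDerivative_apply]
  ring

lemma slash_serre (γ : SL(2, ℤ)) : serreDerivative ((6:ℤ):ℂ) E₆ ∣[(8:ℤ)] γ = serreDerivative ((6:ℤ):ℂ) E₆ := by
  have := serreDerivative_slash_invariant (k := 6) (F := E₆) (holo E₆) (γ := γ)
    (SlashInvariantForm.slash_action_eqn E₆ γ ⟨γ, rfl⟩)
  exact this

noncomputable def Gser : ModularForm 𝒮ℒ 8 where
  toFun := serreDerivative ((6:ℤ):ℂ) E₆
  slash_action_eq' := fun _ ⟨γ, hγ⟩ ↦ hγ ▸ slash_serre γ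
  holo' := serreDerivative_mdifferentiable _ (holo E₆)
  bdd_at_cusps' {c} hc := by
    rw [Subgroup.IsArithmetic.isCusp_iff_isCusp_SL2Z] at hc
    rw [OnePoint.isBoundedAt_iff_forall_SL2Z hc]
    intro γ _
    rw [slash_serre γ]
    exact isBoundedAtImInfty_of_hasSum_qExpansion one_pos PSx_serre

lemma coe_Gser : (Gser : ℍ → ℂ) = serreDerivative ((6:ℤ):ℂ) E₆ := rfl

lemma Gq : qExpansion 1 Gser = (PowerSeries.mk fun m ↦ m * (qExpansion 1 E₆).coeff m) + (-(1/2) : ℂ) • (QE2 * qExpansion 1 E₆) :=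
  PSx.unique Gser PSx_serre

lemma Gser_eq : qExpansion 1 Gser = (-(1/2) : ℂ) • (qExpansion 1 E₄) ^ 2 := by
  have key : Gser + (1/2 : ℂ) • ModularForm.mcast (by decide) (E₄.pow 2) = 0 := by
    apply sturm_bound_levelOne
    rw [FunLike.coe_add, ModularForm.qExpansion_add one_pos one_mem_strictPeriods_SL, FunLike.coe_smul,
      ModularForm.qExpansion_smul one_pos one_mem_strictPeriods_SL, coe_mcast,
      ModularForm.qExpansion_pow one_pos one_mem_strictPeriods_SL, Gq]
    apply lt_of_lt_of_le (b := (1 : ℕ∞))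
    · norm_num
    · apply PowerSeries.le_order
      intro i hi
      have : i = 0 := by
        have : i < 1 := by exact_mod_cast hi
        omega
      subst this
      simp [pow_two, PowerSeries.coeff_mul, QE2, -PowerSeries.coeff_zero_eq_constantCoeff,
        E_qExpansion_coeff_zero _ ⟨2, rfl⟩, E_qExpansion_coeff_zero _ ⟨3, rfl⟩]
  have h2 : Gser = (-(1/2) : ℂ) • ModularForm.mcast (by decide) (E₄.pow 2) := by
    rw [eq_neg_of_add_eq_zero_left key]; ext z; simp
  rw [h2, FunLike.coe_smul, ModularForm.qExpansion_smul one_pos one_mem_strictPeriods_SL, coe_mcast,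
      ModularForm.qExpansion_pow one_pos one_mem_strictPeriods_SL]

lemma disc_q : (1728 : ℂ) • qExpansion 1 CuspForm.discriminant = (qExpansion 1 E₄)^3 - (qExpansion 1 E₆)^2 := by
  have h : (((1728:ℂ) • CuspForm.discriminant : CuspForm 𝒮ℒ 12) : ℍ → ℂ) = (ModularForm.mcast (by decide) (E₄.pow 3) - ModularForm.mcast (by decide) (E₆.pow 2) : ModularForm 𝒮ℒ 12) := by
    ext z
    have := discriminant_eq_E₄_cube_sub_E₆_sq z
    have e1 : (E₄.pow 3) z = E₄ z ^ 3 := congrFun (ModularForm.coe_pow E₄ 3) z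
    have e2 : (E₆.pow 2) z = E₆ z ^ 2 := congrFun (ModularForm.coe_pow E₆ 2) z
    simp [this, coe_mcast, e1, e2]
    field_simp
  have h2 := congrArg (qExpansion 1) h
  rw [FunLike.coe_smul, ModularForm.qExpansion_smul one_pos one_mem_strictPeriods_SL] at h2
  rw [h2, FunLike.coe_sub, ModularForm.qExpansion_sub one_pos one_mem_strictPeriods_SL]
  simp only [coe_mcast, ModularForm.qExpansion_pow one_pos one_mem_strictPeriods_SL]

end partA

section partB
open Filter Topology

lemma tlu_iter {p : ℕ → Polynomial ℂ} {f : ℂ → ℂ} {U : Set ℂ} (hU : IsOpen U)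
    (h : TendstoLocallyUniformlyOn (fun N q ↦ (p N).eval q) f atTop U) (m : ℕ) :
    TendstoLocallyUniformlyOn (fun N q ↦ (Polynomial.derivative^[m] (p N)).eval q)
      (iteratedDeriv m f) atTop U := by
  induction m with
  | zero => simpa using h
  | succ m ih =>
    have := ih.deriv (.of_forall fun N ↦ (Polynomial.differentiable _).differentiableOn) hU
    rw [iteratedDeriv_succ]
    refine this.congr ?_
    intro N q hq
    simp [Function.iterate_succ_apply']

lemma coeff_lim {p : ℕ → Polynomial ℂ} {f : ℂ → ℂ} {U : Set ℂ} (hU : IsOpen U) (h0 : (0:ℂ) ∈ U)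
    (h : TendstoLocallyUniformlyOn (fun N q ↦ (p N).eval q) f atTop U) (m : ℕ) (c : ℂ)
    (hc : ∀ N, m ≤ N → (p N).coeff m = c) : iteratedDeriv m f 0 = m.factorial * c := by
  have h1 := (tlu_iter hU h m).tendsto_at h0
  refine tendsto_nhds_unique h1 ?_
  refine tendsto_const_nhds.congr' ?_
  filter_upwards [eventually_ge_atTop m] with N hN
  rw [← Polynomial.coeff_zero_eq_eval_zero, Polynomial.coeff_iterate_derivative]
  simp [Nat.descFactorial_self, hc N hN]

lemma tau_stable (m N : ℕ) (h : m ≤ N) :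
    (Polynomial.X * ∏ k ∈ Finset.Icc 1 N, ((1 : Polynomial ℤ) - Polynomial.X ^ k) ^ 24).coeff m
      = ramanujanTau m := by
  induction N, h using Nat.le_induction with
  | base => rfl
  | succ N hN ih =>
    rw [← ih, Finset.prod_Icc_succ_top (by omega)]
    obtain ⟨r, hr⟩ : (Polynomial.X : Polynomial ℤ)^(N+1) ∣ (1 - Polynomial.X^(N+1))^24 - 1 := by
      have := sub_dvd_pow_sub_pow (1 - (Polynomial.X : Polynomial ℤ)^(N+1)) 1 24
      rw [one_pow] at this
      refine dvd_trans ⟨-1, by ring⟩ this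
    rw [sub_eq_iff_eq_add.mp hr]
    rw [show ∀ a : Polynomial ℤ, Polynomial.X * (a * (Polynomial.X^(N+1) * r + 1)) = Polynomial.X * a + (Polynomial.X * a * r) * Polynomial.X^(N+1) by intro a; ring]
    rw [Polynomial.coeff_add, Polynomial.coeff_mul_X_pow', if_neg (by omega), add_zero]

lemma disc_coeff (m : ℕ) : (UpperHalfPlane.qExpansion 1 ModularForm.discriminant).coeff m = (ramanujanTau m : ℂ) := by
  set p : ℕ → Polynomial ℂ := fun N ↦ (Polynomial.X * ∏ k ∈ Finset.Icc 1 N, ((1 : Polynomial ℤ) - Polynomial.X ^ k) ^ 24).map (Int.castRingHom ℂ) with hp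
  have base := ModularForm.multipliableLocallyUniformlyOn_one_sub_pow.hasProdLocallyUniformlyOn.tendstoLocallyUniformlyOn_finsetRange
  have hc := ModularForm.differentiableOn_tprod_one_sub_pow.continuousOn
  have pw : ∀ j : ℕ, TendstoLocallyUniformlyOn (fun N (q : ℂ) ↦ (∏ i ∈ Finset.range N, (1 - q ^ (i+1)))^j)
      (fun q ↦ (∏' i : ℕ, (1 - q ^ (i+1)))^j) atTop (Metric.ball (0:ℂ) 1) := by
    intro j
    induction j with
    | zero =>
      simp only [pow_zero]
      exact fun u hu x hx ↦ ⟨Set.univ, Filter.univ_mem, .of_forall fun _ y _ ↦ refl_mem_uniformity hu⟩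
    | succ j ih =>
      simp only [pow_succ]
      exact ih.fun_mul₀ base (hc.pow j) hc
  have idt : TendstoLocallyUniformlyOn (fun (_ : ℕ) (q : ℂ) ↦ q) (fun q ↦ q) atTop (Metric.ball (0:ℂ) 1) := 
    fun u hu x hx ↦ ⟨Set.univ, Filter.univ_mem, .of_forall fun _ y _ ↦ refl_mem_uniformity hu⟩
  have tot := idt.fun_mul₀ (pw 24) continuousOn_id (hc.pow 24)
  have tot2 : TendstoLocallyUniformlyOn (fun N q ↦ (p N).eval q) (UpperHalfPlane.cuspFunction 1 ModularForm.discriminant) atTop (Metric.ball (0:ℂ) 1) := by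
    refine (tot.congr ?_).congr_right ?_
    · intro N q hq
      simp only [hp, Polynomial.eval_map, Polynomial.eval₂_mul, Polynomial.eval₂_X, Polynomial.eval₂_finsetProd, Polynomial.eval₂_pow, Polynomial.eval₂_sub, Polynomial.eval₂_one, Finset.prod_pow]
      congr 2
      rw [Finset.range_eq_Ico, Finset.prod_Ico_add' (fun i ↦ 1 - q^i) 0 N 1]
      rfl
    · intro q hq
      rw [ModularForm.discriminant_cuspFunction_eqOn hq]
      simp only
      rw [(ModularForm.multipliable_one_sub_pow (by simpa using hq)).tprod_pow 24]
  have := coeff_lim Metric.isOpen_ball (Metric.mem_ball_self one_pos) tot2 m (ramanujanTau m) (by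
    intro N hN
    simp only [hp, Polynomial.coeff_map]
    rw [tau_stable m N hN]
    rfl)
  rw [UpperHalfPlane.qExpansion_coeff, this]
  have : (m.factorial : ℂ) ≠ 0 := by exact_mod_cast m.factorial_ne_zero
  field_simp
end partB

section partC
noncomputable def AZ : PowerSeries ℤ := PowerSeries.mk fun m ↦ if m = 0 then 1 else 240 * (ArithmeticFunction.sigma 3 m : ℤ)
noncomputable def BZ : PowerSeries ℤ := PowerSeries.mk fun m ↦ if m = 0 then 1 else -504 * (ArithmeticFunction.sigma 5 m : ℤ)
noncomputable def CZ : PowerSeries ℤ := PowerSeries.mk fun m ↦ if m = 0 then 1 else -24 * (ArithmeticFunction.sigma 1 m : ℤ)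
noncomputable def BT : PowerSeries ℤ := PowerSeries.mk fun m ↦ m * BZ.coeff m
noncomputable def DZ : PowerSeries ℤ := PowerSeries.mk fun m ↦ ramanujanTau m

lemma map_AZ : PowerSeries.map (Int.castRingHom ℂ) AZ = UpperHalfPlane.qExpansion 1 ModularForm.E₄ := by
  ext m
  rw [EisensteinSeries.E_qExpansion_coeff _ ⟨2, rfl⟩]
  rcases eq_or_ne m 0 with rfl | h
  · simp [AZ]
  · norm_num [AZ, h, show bernoulli 4 = -1 / 30 by decide +kernel]

lemma map_BZ : PowerSeries.map (Int.castRingHom ℂ) BZ = UpperHalfPlane.qExpansion 1 ModularForm.E₆ := by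
  ext m
  rw [EisensteinSeries.E_qExpansion_coeff _ ⟨3, rfl⟩]
  rcases eq_or_ne m 0 with rfl | h
  · simp [BZ]
  · norm_num [BZ, h, show bernoulli 6 = 1 / 42 by decide +kernel]

lemma map_CZ : PowerSeries.map (Int.castRingHom ℂ) CZ = QE2 := by
  ext m
  rcases eq_or_ne m 0 with rfl | h
  · simp [CZ, QE2]
  · simp [CZ, QE2, h]

lemma map_BT : PowerSeries.map (Int.castRingHom ℂ) BT = PowerSeries.mk fun m ↦ m * (UpperHalfPlane.qExpansion 1 ModularForm.E₆).coeff m := by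
  ext m
  rw [← map_BZ]
  simp [BT]

lemma map_DZ : PowerSeries.map (Int.castRingHom ℂ) DZ = UpperHalfPlane.qExpansion 1 CuspForm.discriminant := by
  ext m
  rw [CuspForm.coe_discriminant, disc_coeff]
  simp [DZ]

lemma idZ1 : 2 * BT = CZ * BZ - AZ ^ 2 := by
  apply PowerSeries.map_injective (Int.castRingHom ℂ) Int.cast_injective
  have h := Gser_eq
  rw [Gq, ← map_BT, ← map_AZ, ← map_BZ, ← map_CZ] at h
  simp only [map_mul, map_sub, map_pow, map_ofNat]
  have h2 := congrArg (fun z ↦ (2:ℂ) • z) h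
  simp only [smul_add, smul_smul] at h2
  norm_num at h2
  rw [two_smul] at h2
  linear_combination h2

lemma idZ2 : 1728 * DZ = AZ ^ 3 - BZ ^ 2 := by
  apply PowerSeries.map_injective (Int.castRingHom ℂ) Int.cast_injective
  have h := disc_q
  rw [← map_AZ, ← map_BZ, ← map_DZ] at h
  simp only [map_mul, map_sub, map_pow, map_ofNat]
  rw [← h]
  ext m
  simp [PowerSeries.coeff_smul]
  rw [← map_ofNat (PowerSeries.C (R := ℂ)) 1728, PowerSeries.coeff_C_mul]
  simp

lemma sigma5 (m : ℕ) : ((ArithmeticFunction.sigma 5 m : ℕ) : ZMod 5) = (ArithmeticFunction.sigma 1 m : ℕ) := by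
  have : Fact (Nat.Prime 5) := ⟨by norm_num⟩
  simp only [ArithmeticFunction.sigma_apply, Nat.cast_sum, Nat.cast_pow, pow_one]
  exact Finset.sum_congr rfl fun d _ ↦ ZMod.pow_card _

lemma tau_mod5 (n : ℕ) : ((ramanujanTau n : ℤ) : ZMod 5) = n * (ArithmeticFunction.sigma 1 n : ℕ) := by
  set ψ := PowerSeries.map (Int.castRingHom (ZMod 5)) with hψ
  have c240 : (240 : ZMod 5) = 0 := by decide
  have c504 : (-504 : ZMod 5) = -24 := by decide
  have hA : ψ AZ = 1 := by
    ext m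
    rcases eq_or_ne m 0 with rfl | h
    · simp [hψ, AZ]
    · simp [hψ, AZ, h, PowerSeries.coeff_one, c240]
  have hC : ψ CZ = ψ BZ := by
    ext m
    rcases eq_or_ne m 0 with rfl | h
    · simp [hψ, CZ, BZ]
    · simp only [hψ, CZ, BZ, h, PowerSeries.coeff_map, PowerSeries.coeff_mk, if_false]
      simp only [map_mul, eq_intCast]
      push_cast
      rw [sigma5, c504]
  have h1 := congrArg ψ idZ1
  have h2 := congrArg ψ idZ2
  simp only [map_mul, map_sub, map_pow, map_ofNat, hA, hC, one_pow] at h1 h2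
  have h3 : 1728 * ψ DZ = - (2 * ψ BT) := by rw [h1, h2]; ring
  have h4 := congrArg (PowerSeries.coeff n) h3
  rw [← map_ofNat (PowerSeries.C (R := (ZMod 5))) 1728,
    ← map_ofNat (PowerSeries.C (R := (ZMod 5))) 2, map_neg,
    PowerSeries.coeff_C_mul, PowerSeries.coeff_C_mul] at h4
  simp only [hψ, PowerSeries.coeff_map, DZ, BT, BZ, PowerSeries.coeff_mk, eq_intCast] at h4
  rcases eq_or_ne n 0 with rfl | hn
  · simp [ramanujanTau]
  · rw [if_neg hn] at h4
    push_cast at h4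
    rw [sigma5] at h4
    have e : (2 : ZMod 5) * 1728 = 1 := by decide
    have e2 : (2 : ZMod 5) * (2 * 504) = 1 := by decide
    linear_combination 2 * h4 - ((ramanujanTau n : ℤ) : ZMod 5) * e + (n * (ArithmeticFunction.sigma 1 n : ℕ)) * e2

lemma tau_dvd (n : ℕ) : (5 : ℤ) ∣ ramanujanTau n ↔ 5 ∣ n * ArithmeticFunction.sigma 1 n := by
  rw [← ZMod.natCast_eq_zero_iff, Nat.cast_mul, ← tau_mod5]
  exact (ZMod.intCast_zmod_eq_zero_iff_dvd _ 5).symm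
end partC

section partD

lemma t5_eq (n : ℕ) : t5 n = if 5 ∣ n * ArithmeticFunction.sigma 1 n then 0 else 1 := by
  unfold t5
  simp only [tau_dvd]

lemma t5_mul {m n : ℕ} (h : Nat.Coprime m n) : t5 (m * n) = t5 m * t5 n := by
  simp only [t5_eq]
  rw [ArithmeticFunction.isMultiplicative_sigma.map_mul_of_coprime h]
  have : m * n * (ArithmeticFunction.sigma 1 m * ArithmeticFunction.sigma 1 n) =
      (m * ArithmeticFunction.sigma 1 m) * (n * ArithmeticFunction.sigma 1 n) := by ring
  rw [this]
  simp only [Nat.Prime.dvd_mul (show Nat.Prime 5 by norm_num)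
    (m := m * ArithmeticFunction.sigma 1 m)]
  by_cases h1 : 5 ∣ m * ArithmeticFunction.sigma 1 m <;>
  by_cases h2 : 5 ∣ n * ArithmeticFunction.sigma 1 n <;> simp only [h1, h2] <;> norm_num

lemma t5_zero : t5 0 = 0 := by simp [t5_eq]

lemma t5_one : t5 1 = 1 := by simp [t5_eq]

lemma t5_nonneg (n : ℕ) : 0 ≤ t5 n := by unfold t5; split_ifs <;> norm_num

lemma t5_le (n : ℕ) : t5 n ≤ 1 := by unfold t5; split_ifs <;> norm_num

lemma t5_five_pow (k : ℕ) : t5 (5 ^ (k + 1)) = 0 := by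
  rw [t5_eq, if_pos]
  exact Dvd.dvd.mul_right (dvd_pow_self 5 (by omega)) _

/-- The geometric sum mod 5. -/
def gs (a : ZMod 5) (k : ℕ) : ZMod 5 := ∑ i ∈ Finset.range (k + 1), a ^ i

lemma t5_pow {p : ℕ} (hp : p.Prime) (h5 : p ≠ 5) (k : ℕ) :
    t5 (p ^ k) = if gs p k = 0 then 0 else 1 := by
  have hc : ¬ 5 ∣ p ^ k := fun h ↦ h5 ((Nat.prime_dvd_prime_iff_eq (by norm_num) hp).mp
    (Nat.Prime.dvd_of_dvd_pow (by norm_num) h)).symm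
  have key : 5 ∣ p ^ k * ArithmeticFunction.sigma 1 (p ^ k) ↔ gs p k = 0 := by
    rw [Nat.Prime.dvd_mul (by norm_num), ArithmeticFunction.sigma_one_apply_prime_pow hp,
      ← ZMod.natCast_eq_zero_iff (∑ k ∈ Finset.range (k + 1), p ^ k)]
    simp [hc, gs]
  rw [t5_eq]
  simp only [key]

lemma gs_add (a : ZMod 5) (k d : ℕ) (h : gs a d = 0) : gs a (k + (d + 1)) = a ^ (d + 1) * gs a k := by
  unfold gs at *
  rw [show k + (d + 1) + 1 = (d + 1) + (k + 1) by ring, Finset.sum_range_add, h, zero_add,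
    Finset.mul_sum]
  simp [pow_add]

lemma gs_periodic (a : ZMod 5) (ha : a ≠ 0) (k d : ℕ) (h : gs a d = 0) :
    gs a (k + (d + 1)) = 0 ↔ gs a k = 0 := by
  have : Fact (Nat.Prime 5) := ⟨by norm_num⟩
  rw [gs_add a k d h]
  simp [ha]

lemma tsum_periodic (c : ℕ → ℝ) (hc0 : ∀ k, 0 ≤ c k) (hc1 : ∀ k, c k ≤ 1) (d : ℕ)
    (hper : ∀ k, c (k + d) = c k) {x : ℝ} (hx0 : 0 ≤ x) (hx1 : x < 1) :
    (∑' k, c k * x ^ k) * (1 - x ^ d) = ∑ k ∈ Finset.range d, c k * x ^ k := by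
  have hs : Summable fun k ↦ c k * x ^ k := by
    refine Summable.of_nonneg_of_le (fun k ↦ mul_nonneg (hc0 k) (by positivity)) (fun k ↦ ?_)
      (summable_geometric_of_lt_one hx0 hx1)
    exact mul_le_of_le_one_left (by positivity) (hc1 k)
  have h := hs.sum_add_tsum_nat_add d
  have h2 : ∑' k, c (k + d) * x ^ (k + d) = (∑' k, c k * x ^ k) * x ^ d := by
    rw [← tsum_mul_right]
    refine tsum_congr fun k ↦ ?_
    rw [hper, pow_add]; ring
  rw [h2] at h
  linarith

lemma euler_factor {p : ℕ} (hp : p.Prime) (h5 : p ≠ 5) (a : ZMod 5) (hpa : (p : ZMod 5) = a)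
    (ha : a ≠ 0) (d : ℕ) (hd : gs a d = 0) {x : ℝ} (hx0 : 0 ≤ x) (hx1 : x < 1) :
    (∑' k, t5 (p ^ k) * x ^ k) * (1 - x ^ (d + 1)) =
      ∑ k ∈ Finset.range (d + 1), (if gs a k = 0 then 0 else 1) * x ^ k := by
  rw [tsum_periodic (fun k ↦ t5 (p ^ k)) (fun k ↦ t5_nonneg _) (fun k ↦ t5_le _) (d + 1) ?_ hx0 hx1]
  · refine Finset.sum_congr rfl fun k _ ↦ ?_
    simp only [t5_pow hp h5, hpa]
  · intro k
    simp only [t5_pow hp h5, hpa, gs_periodic a ha k d hd]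

lemma euler_five {x : ℝ} : (∑' k, t5 (5 ^ k) * x ^ k) = 1 := by
  rw [tsum_eq_single 0]
  · simp [t5_one]
  · intro k hk
    obtain ⟨j, rfl⟩ := Nat.exists_eq_succ_of_ne_zero hk
    rw [Nat.succ_eq_add_one, t5_five_pow, zero_mul]

lemma cast_mod {p r : ℕ} (h : p % 5 = r) : (p : ZMod 5) = r := by
  rw [← h]; simp

lemma euler1 {p : ℕ} (hp : p.Prime) (h : p % 5 = 1) {x : ℝ} (hx0 : 0 ≤ x) (hx1 : x < 1) :
    (∑' k, t5 (p ^ k) * x ^ k) * (1 - x ^ 5) = 1 + x + x ^ 2 + x ^ 3 := by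
  have := euler_factor hp (by rintro rfl; simp at h) 1 (by simpa using cast_mod h) (by decide) 4
    (by decide) hx0 hx1
  rw [this]
  simp only [Finset.sum_range_succ, Finset.sum_range_zero]
  rw [if_neg (by decide), if_neg (by decide), if_neg (by decide), if_neg (by decide), if_pos (by decide)]
  ring

lemma euler4 {p : ℕ} (hp : p.Prime) (h : p % 5 = 4) {x : ℝ} (hx0 : 0 ≤ x) (hx1 : x < 1) :
    (∑' k, t5 (p ^ k) * x ^ k) * (1 - x ^ 2) = 1 := by
  have := euler_factor hp (by rintro rfl; simp at h) 4 (by simpa using cast_mod h) (by decide) 1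
    (by decide) hx0 hx1
  rw [this]
  simp only [Finset.sum_range_succ, Finset.sum_range_zero]
  rw [if_neg (by decide), if_pos (by decide)]
  ring

lemma euler23 {p : ℕ} (hp : p.Prime) (h : p % 5 = 2 ∨ p % 5 = 3) {x : ℝ} (hx0 : 0 ≤ x) (hx1 : x < 1) :
    (∑' k, t5 (p ^ k) * x ^ k) * (1 - x ^ 4) = 1 + x + x ^ 2 := by
  rcases h with h | h
  · have := euler_factor hp (by rintro rfl; simp at h) 2 (by simpa using cast_mod h) (by decide) 3
      (by decide) hx0 hx1
    rw [this]
    simp only [Finset.sum_range_succ, Finset.sum_range_zero]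
    rw [if_neg (by decide), if_neg (by decide), if_neg (by decide), if_pos (by decide)]
    ring
  · have := euler_factor hp (by rintro rfl; simp at h) 3 (by simpa using cast_mod h) (by decide) 3
      (by decide) hx0 hx1
    rw [this]
    simp only [Finset.sum_range_succ, Finset.sum_range_zero]
    rw [if_neg (by decide), if_neg (by decide), if_neg (by decide), if_pos (by decide)]
    ring

lemma T_hasProd (s : ℝ) (hs : 1 < s) :
    HasProd (fun p : Nat.Primes ↦ ∑' k, t5 ((p : ℕ) ^ k) * (((p : ℕ) : ℝ) ^ (-s)) ^ k)
      (∑' n : ℕ, t5 (n + 1) / ((n : ℝ) + 1) ^ s) := by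
  set f : ℕ → ℝ := fun n ↦ t5 n * (n : ℝ) ^ (-s) with hf
  have hsum : Summable (fun n ↦ ‖f n‖) := by
    refine Summable.of_nonneg_of_le (fun n ↦ norm_nonneg _) (fun n ↦ ?_)
      (Real.summable_nat_rpow.mpr (show -s < -1 by linarith))
    rw [hf, Real.norm_of_nonneg (mul_nonneg (t5_nonneg _) (by positivity))]
    exact mul_le_of_le_one_left (by positivity) (t5_le n)
  have h := EulerProduct.eulerProduct_hasProd (f := f) (by simp [hf, t5_one])
    (by
      intro m n hmn
      simp only [hf, t5_mul hmn, Nat.cast_mul]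
      rw [Real.mul_rpow (by positivity) (by positivity)]; ring) hsum (by simp [hf, t5_zero])
  have e1 : ∑' n : ℕ, t5 (n + 1) / ((n : ℝ) + 1) ^ s = ∑' n, f n := by
    rw [hsum.of_norm.tsum_eq_zero_add]
    have : f 0 = 0 := by simp [hf, t5_zero]
    rw [this, zero_add]
    refine tsum_congr fun n ↦ ?_
    simp only [hf]
    rw [Real.rpow_neg (by positivity)]
    push_cast
    rfl
  rw [e1]
  have e2 : (fun p : Nat.Primes ↦ ∑' k, t5 ((p : ℕ) ^ k) * (((p : ℕ) : ℝ) ^ (-s)) ^ k) =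
      fun p : Nat.Primes ↦ ∑' k, f ((p : ℕ) ^ k) := by
    funext p
    refine tsum_congr fun k ↦ ?_
    simp only [hf, Nat.cast_pow]
    rw [← Real.rpow_natCast, ← Real.rpow_natCast, ← Real.rpow_mul (by positivity),
      ← Real.rpow_mul (by positivity), mul_comm (-s)]
  rw [e2]
  exact h

lemma mult_sub {ι : Type*} (g : ι → ℕ) (hg : Function.Injective g) {u : ℝ}
    (hu : 1 < u) : Multipliable fun i ↦ 1 - (g i : ℝ) ^ (-u) := by
  have hs : Summable fun i ↦ (g i : ℝ) ^ (-u) :=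
    (Real.summable_nat_rpow.mpr (show -u < -1 by linarith)).comp_injective hg
  have := multipliable_one_add_of_summable (f := fun i ↦ -((g i : ℝ) ^ (-u))) (by simpa using hs.norm)
  simpa [sub_eq_add_neg] using this

lemma rpow_le_half {p : ℕ} (hp : 2 ≤ p) {u : ℝ} (hu : 1 < u) : (p : ℝ) ^ (-u) ≤ 1 / 2 := by
  have h2 : (2 : ℝ) ≤ p := by exact_mod_cast hp
  calc (p : ℝ) ^ (-u) ≤ (p : ℝ) ^ (-1 : ℝ) :=
        Real.rpow_le_rpow_of_exponent_le (by linarith) (by linarith)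
    _ = (p : ℝ)⁻¹ := Real.rpow_neg_one _
    _ ≤ 1 / 2 := by rw [one_div]; exact inv_anti₀ (by norm_num) h2

lemma mult_inv {ι : Type*} (g : ι → ℕ) (hg : Function.Injective g) (hg2 : ∀ i, 2 ≤ g i) {u : ℝ}
    (hu : 1 < u) : Multipliable fun i ↦ (1 - (g i : ℝ) ^ (-u))⁻¹ := by
  have hs : Summable fun i ↦ (g i : ℝ) ^ (-u) :=
    (Real.summable_nat_rpow.mpr (show -u < -1 by linarith)).comp_injective hg
  have := multipliable_one_add_of_summable
    (f := fun i ↦ (g i : ℝ) ^ (-u) / (1 - (g i : ℝ) ^ (-u))) (by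
      refine Summable.of_nonneg_of_le (fun _ ↦ norm_nonneg _) (fun i ↦ ?_) (hs.mul_left 2)
      have h1 := rpow_le_half (hg2 i) hu
      have h0 : 0 ≤ (g i : ℝ) ^ (-u) := by positivity
      rw [Real.norm_of_nonneg (div_nonneg h0 (by linarith)), div_le_iff₀ (by linarith)]
      nlinarith)
  refine this.congr fun i ↦ ?_
  have h1 := rpow_le_half (hg2 i) hu
  have : 1 - (g i : ℝ) ^ (-u) ≠ 0 := by linarith
  field_simp
  ring

lemma subtype_hasProd (P : ℕ → Prop) [DecidablePred P] (F : ℕ → ℝ)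
    (h : Multipliable fun p : {p : ℕ // p.Prime ∧ P p} ↦ F p.1) :
    HasProd (fun p : Nat.Primes ↦ if P p then F p else 1)
      (∏' p : {p : ℕ // p.Prime ∧ P p}, F p.1) := by
  set g : {p : ℕ // p.Prime ∧ P p} → Nat.Primes := fun p ↦ ⟨p.1, p.2.1⟩
  have hg : Function.Injective g := by
    intro a b hab
    exact Subtype.ext (congrArg (fun z : Nat.Primes ↦ (z : ℕ)) hab)
  rw [← hg.hasProd_iff]
  · have e : (fun p : Nat.Primes ↦ if P p then F p else 1) ∘ g = fun p ↦ F p.1 := by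
      funext p
      exact if_pos p.2.2
    rw [e]
    exact h.hasProd
  · intro p hp
    refine if_neg fun hP ↦ hp ⟨⟨p.1, p.2, hP⟩, rfl⟩

lemma H5_hasProd (s : ℝ) (hs : 1 < s) :
    HasProd (fun p : Nat.Primes ↦
      (if (p : ℕ) % 5 = 1 then ((1 - ((p:ℕ) : ℝ) ^ (-(4 * s))) / (1 - ((p:ℕ) : ℝ) ^ (-(5 * s)))) ^ 4 else 1)
      * (if ((p : ℕ) % 5 = 2 ∨ (p : ℕ) % 5 = 3) then (1 - ((p:ℕ) : ℝ) ^ (-(3 * s))) ^ 4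
          / ((1 - ((p:ℕ) : ℝ) ^ (-(2 * s))) ^ 2 * (1 - ((p:ℕ) : ℝ) ^ (-(4 * s))) ^ 3) else 1)
      * (if (p : ℕ) % 5 = 4 then ((1 - ((p:ℕ) : ℝ) ^ (-(2 * s))) ^ 2)⁻¹ else 1)) (H5 s) := by
  refine ((subtype_hasProd (fun p ↦ p % 5 = 1) (fun p ↦ ((1 - (p : ℝ) ^ (-(4 * s))) / (1 - (p : ℝ) ^ (-(5 * s)))) ^ 4) ?_).mul
    (subtype_hasProd (fun p ↦ p % 5 = 2 ∨ p % 5 = 3) (fun p ↦ (1 - (p : ℝ) ^ (-(3 * s))) ^ 4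
          / ((1 - (p : ℝ) ^ (-(2 * s))) ^ 2 * (1 - (p : ℝ) ^ (-(4 * s))) ^ 3)) ?_)).mul
    (subtype_hasProd (fun p ↦ p % 5 = 4) (fun p ↦ ((1 - (p : ℝ) ^ (-(2 * s))) ^ 2)⁻¹) ?_)
  · have a := mult_sub (fun p : {p : ℕ // p.Prime ∧ p % 5 = 1} ↦ p.1) Subtype.val_injective
      (show 1 < 4 * s by linarith)
    have b := mult_inv (fun p : {p : ℕ // p.Prime ∧ p % 5 = 1} ↦ p.1) Subtype.val_injective
      (fun p ↦ p.2.1.two_le) (show 1 < 5 * s by linarith)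
    exact ((a.mul b).pow 4).congr fun p ↦ by rw [div_eq_mul_inv]
  · have a := mult_sub (fun p : {p : ℕ // p.Prime ∧ (p % 5 = 2 ∨ p % 5 = 3)} ↦ p.1) Subtype.val_injective
      (show 1 < 3 * s by linarith)
    have b := mult_inv (fun p : {p : ℕ // p.Prime ∧ (p % 5 = 2 ∨ p % 5 = 3)} ↦ p.1) Subtype.val_injective
      (fun p ↦ p.2.1.two_le) (show 1 < 2 * s by linarith)
    have c := mult_inv (fun p : {p : ℕ // p.Prime ∧ (p % 5 = 2 ∨ p % 5 = 3)} ↦ p.1) Subtype.val_injective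
      (fun p ↦ p.2.1.two_le) (show 1 < 4 * s by linarith)
    exact ((a.pow 4).mul ((b.pow 2).mul (c.pow 3))).congr fun p ↦ by
      rw [div_eq_mul_inv, mul_inv, inv_pow, inv_pow]
  · have b := mult_inv (fun p : {p : ℕ // p.Prime ∧ p % 5 = 4} ↦ p.1) Subtype.val_injective
      (fun p ↦ p.2.1.two_le) (show 1 < 2 * s by linarith)
    exact (b.pow 2).congr fun p ↦ by rw [inv_pow]

lemma five_hasProd (y : ℂ) :
    HasProd (fun p : Nat.Primes ↦ if (p : ℕ) % 5 = 0 then y else 1) y := by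
  classical
  obtain ⟨q, hq⟩ : ∃ q : Nat.Primes, (q : ℕ) = 5 := ⟨⟨5, by norm_num⟩, rfl⟩
  have e : (fun p : Nat.Primes ↦ if (p : ℕ) % 5 = 0 then y else 1) =
      fun p : Nat.Primes ↦ if p = q then y else 1 := by
    funext p
    have : (p : ℕ) % 5 = 0 ↔ p = q := by
      rw [← Nat.dvd_iff_mod_eq_zero, Nat.prime_dvd_prime_iff_eq (by norm_num) p.2]
      constructor
      · intro h; exact Subtype.ext (h.symm.trans hq.symm)
      · intro h; rw [h]; exact hq.symm
    by_cases h : p = q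
    · rw [if_pos h, if_pos (this.mpr h)]
    · rw [if_neg h, if_neg (fun h' ↦ h (this.mp h'))]
  rw [e]
  exact hasProd_ite_eq q y

lemma rpow_pow_eq (p : ℕ) (k : ℕ) (s : ℝ) : (p : ℝ) ^ (-((k : ℝ) * s)) = ((p : ℝ) ^ (-s)) ^ k := by
  rw [← Real.rpow_natCast, ← Real.rpow_mul (by positivity)]
  ring_nf

lemma alg1 {x E : ℂ} (h1 : 1 - x ≠ 0) (h5 : 1 - x ^ 5 ≠ 0)
    (hE : E * (1 - x ^ 5) = 1 + x + x ^ 2 + x ^ 3) :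
    E ^ 4 * (1 - 1 * x)⁻¹ = ((1 - x ^ 4) / (1 - x ^ 5)) ^ 4 * ((1 - x)⁻¹) ^ 3
      * (1 - 1 * x)⁻¹ * (1 - 1 * x)⁻¹ := by
  rw [eq_div_of_mul_eq h5 hE, one_mul]
  field_simp
  ring

lemma alg4 {x E : ℂ} (h1 : 1 - x ≠ 0) (h1' : 1 + x ≠ 0)
    (hE : E * (1 - x ^ 2) = 1) :
    E ^ 4 * (1 - 1 * x)⁻¹ = ((1 - x ^ 2) ^ 2)⁻¹ * ((1 - x)⁻¹) ^ 3
      * (1 - (-1) * x)⁻¹ * (1 - (-1) * x)⁻¹ := by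
  have e : 1 - x ^ 2 = (1 - x) * (1 + x) := by ring
  have h2 : 1 - x ^ 2 ≠ 0 := by rw [e]; exact mul_ne_zero h1 h1'
  rw [eq_div_of_mul_eq h2 hE, e, one_mul, show 1 - (-1) * x = 1 + x by ring]
  field_simp

lemma alg2 {x E : ℂ} (h1 : 1 - x ≠ 0) (h1' : 1 + x ≠ 0) (h2 : 1 + x ^ 2 ≠ 0)
    (hE : E * (1 - x ^ 4) = 1 + x + x ^ 2) :
    E ^ 4 * (1 - (-1) * x)⁻¹ = (1 - x ^ 3) ^ 4 / ((1 - x ^ 2) ^ 2 * (1 - x ^ 4) ^ 3)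
      * ((1 - x)⁻¹) ^ 3 * (1 + x ^ 2)⁻¹ := by
  have e : 1 - x ^ 2 = (1 - x) * (1 + x) := by ring
  have e4 : 1 - x ^ 4 = (1 - x) * (1 + x) * (1 + x ^ 2) := by ring
  have h4 : 1 - x ^ 4 ≠ 0 := by rw [e4]; exact mul_ne_zero (mul_ne_zero h1 h1') h2
  rw [eq_div_of_mul_eq h4 hE, e, e4, show 1 - (-1) * x = 1 + x by ring]
  field_simp
  ring

lemma alg_I (x : ℂ) : (1 - Complex.I * x)⁻¹ * (1 - (-Complex.I) * x)⁻¹ = (1 + x ^ 2)⁻¹ := by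
  rw [← mul_inv]
  congr 1
  linear_combination (-x ^ 2) * Complex.I_sq

end partD

/-- `T(s)^4 = (1-5^{-s})^3 H(s) ζ(s)^3 L(s,χ_c) L(s,χ̄_c) / L(s,χ₅)`, where `χ_c` is
the character mod 5 with `χ_c(2) = i`, `χ̄_c` its complex conjugate, and `χ₅` the
character mod 5 with `χ₅(2) = -1`. -/
theorem T_five_fourth_power (s : ℝ) (hs : 1 < s)
    (χc χcbar χ5 : DirichletCharacter ℂ 5)
    (hχc : χc 2 = Complex.I)
    (hχcbar : ∀ a : ZMod 5, χcbar a = (starRingEnd ℂ) (χc a))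
    (hχ5 : χ5 2 = -1) :
    (((∑' n : ℕ, t5 (n + 1) / ((n : ℝ) + 1) ^ s : ℝ) : ℂ)) ^ 4
      = (1 - (5 : ℂ) ^ (-(s : ℂ))) ^ 3 * (H5 s : ℂ) * riemannZeta s ^ 3
        * DirichletCharacter.LFunction χc s * DirichletCharacter.LFunction χcbar s
        / DirichletCharacter.LFunction χ5 s := by
  have hs' : 1 < (s : ℂ).re := by simpa using hs
  have hT := ((T_hasProd s hs).map Complex.ofRealHom.toMonoidHom Complex.continuous_ofReal).pow 4
  have hH := (H5_hasProd s hs).map Complex.ofRealHom.toMonoidHom Complex.continuous_ofReal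
  have hZ := (riemannZeta_eulerProduct_hasProd hs').pow 3
  have hL : ∀ χ : DirichletCharacter ℂ 5,
      HasProd (fun p : Nat.Primes ↦ (1 - χ p * (p : ℂ) ^ (-(s : ℂ)))⁻¹)
        (DirichletCharacter.LFunction χ s) := fun χ ↦ by
    rw [DirichletCharacter.LFunction_eq_LSeries χ hs']
    exact DirichletCharacter.LSeries_eulerProduct_hasProd χ hs'
  have h5 := five_hasProd ((1 - (5 : ℂ) ^ (-(s : ℂ))) ^ 3)
  have hne : DirichletCharacter.LFunction χ5 s ≠ 0 := by
    rw [DirichletCharacter.LFunction_eq_LSeries χ5 hs']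
    exact DirichletCharacter.LSeries_ne_zero_of_one_lt_re χ5 hs'
  rw [eq_div_iff hne]
  refine (hT.mul (hL χ5)).unique ?_
  have hR := (((h5.mul hH).mul hZ).mul (hL χc)).mul (hL χcbar)
  refine Eq.mpr ?_ hR
  congr 1
  funext p
  obtain ⟨p, hp⟩ := p
  change ((∑' k, t5 (p ^ k) * ((p : ℝ) ^ (-s)) ^ k : ℝ) : ℂ) ^ 4 * (1 - χ5 p * (p : ℂ) ^ (-(s : ℂ)))⁻¹ =
    (if p % 5 = 0 then (1 - (5 : ℂ) ^ (-(s : ℂ))) ^ 3 else 1) *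
    (((if p % 5 = 1 then ((1 - (p : ℝ) ^ (-(4 * s))) / (1 - (p : ℝ) ^ (-(5 * s)))) ^ 4 else 1)
      * (if (p % 5 = 2 ∨ p % 5 = 3) then (1 - (p : ℝ) ^ (-(3 * s))) ^ 4
          / ((1 - (p : ℝ) ^ (-(2 * s))) ^ 2 * (1 - (p : ℝ) ^ (-(4 * s))) ^ 3) else 1)
      * (if p % 5 = 4 then ((1 - (p : ℝ) ^ (-(2 * s))) ^ 2)⁻¹ else 1) : ℝ) : ℂ) *
    ((1 - (p : ℂ) ^ (-(s : ℂ)))⁻¹) ^ 3 * (1 - χc p * (p : ℂ) ^ (-(s : ℂ)))⁻¹ *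
    (1 - χcbar p * (p : ℂ) ^ (-(s : ℂ)))⁻¹
  have hx0 : 0 ≤ (p : ℝ) ^ (-s) := by positivity
  have hx12 := rpow_le_half hp.two_le hs
  have hcast : (p : ℂ) ^ (-(s : ℂ)) = (((p : ℝ) ^ (-s) : ℝ) : ℂ) := by
    rw [Complex.ofReal_cpow (by positivity)]; simp
  have r2 := rpow_pow_eq p 2 s
  have r3 := rpow_pow_eq p 3 s
  have r4 := rpow_pow_eq p 4 s
  have r5 := rpow_pow_eq p 5 s
  push_cast at r2 r3 r4 r5
  rw [r2, r3, r4, r5, hcast, hχcbar]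
  have hfive : p % 5 = 0 → p = 5 := fun h ↦
    ((Nat.prime_dvd_prime_iff_eq (by norm_num) hp).mp (Nat.dvd_of_mod_eq_zero h)).symm
  have c5 : p = 5 → (5 : ℂ) ^ (-(s : ℂ)) = (((p : ℝ) ^ (-s) : ℝ) : ℂ) := by
    intro h; rw [← hcast, h]; norm_num
  have e5 : p = 5 → ∑' k, t5 (p ^ k) * ((p : ℝ) ^ (-s)) ^ k = 1 := by
    rintro rfl; exact euler_five
  have E1 := fun h ↦ euler1 hp h hx0 (by linarith)
  have E23 := fun h ↦ euler23 hp h hx0 (by linarith)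
  have E4 := fun h ↦ euler4 hp h hx0 (by linarith)
  generalize (∑' k, t5 (p ^ k) * ((p : ℝ) ^ (-s)) ^ k) = E at *
  generalize (p : ℝ) ^ (-s) = x at *
  have n1 : (1 : ℂ) - x ≠ 0 := by
    have : 1 - x ≠ 0 := by linarith
    exact_mod_cast this
  have n1' : (1 : ℂ) + x ≠ 0 := by
    have : 1 + x ≠ 0 := by linarith
    exact_mod_cast this
  have n2 : (1 : ℂ) + x ^ 2 ≠ 0 := by
    have : 1 + x ^ 2 ≠ 0 := by positivity
    exact_mod_cast this
  have n5 : (1 : ℂ) - x ^ 5 ≠ 0 := by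
    have : x ^ 5 < 1 := pow_lt_one₀ hx0 (by linarith) (by norm_num)
    have : 1 - x ^ 5 ≠ 0 := by linarith
    exact_mod_cast this
  have v4 : ∀ χ : DirichletCharacter ℂ 5, χ 4 = χ 2 * χ 2 := fun χ ↦ by
    rw [← map_mul]; rfl
  have v3 : ∀ χ : DirichletCharacter ℂ 5, χ 3 = χ 2 * χ 2 * χ 2 := fun χ ↦ by
    rw [← map_mul, ← map_mul]; rfl
  have v0 : ∀ χ : DirichletCharacter ℂ 5, χ 0 = 0 := fun χ ↦
    MulChar.map_nonunit χ (by decide)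
  have : p % 5 = 0 ∨ p % 5 = 1 ∨ p % 5 = 2 ∨ p % 5 = 3 ∨ p % 5 = 4 := by omega
  rcases this with h | h | h | h | h
  · have hc := cast_mod h
    rw [hc, c5 (hfive h), e5 (hfive h)]
    simp [h, v0]
    field_simp
  · have hc := cast_mod h
    rw [hc]
    have hE : (E : ℂ) * (1 - x ^ 5) = 1 + x + x ^ 2 + x ^ 3 := by exact_mod_cast E1 h
    have := alg1 n1 n5 hE
    simp [h]
    simpa using this
  · have hc := cast_mod h
    rw [hc]
    have hE : (E : ℂ) * (1 - x ^ 4) = 1 + x + x ^ 2 := by exact_mod_cast E23 (Or.inl h)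
    have := alg2 n1 n1' n2 hE
    rw [← alg_I] at this
    simp [h, hχc, hχ5] at this ⊢
    rw [this]; ring
  · have hc := cast_mod h
    rw [hc]
    have hE : (E : ℂ) * (1 - x ^ 4) = 1 + x + x ^ 2 := by exact_mod_cast E23 (Or.inr h)
    have := alg2 n1 n1' n2 hE
    rw [← alg_I] at this
    simp [h, hχc, hχ5, v3] at this ⊢
    rw [this]; ring
  · have hc := cast_mod h
    rw [hc]
    have hE : (E : ℂ) * (1 - x ^ 2) = 1 := by exact_mod_cast E4 h
    have := alg4 n1 n1' hE
    simp [h, hχc, hχ5, v4] at this ⊢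
    rw [this]
end

section
/- Let χ_c be the Dirichlet character modulo 5 determined by χ_c(2) = i, and let χ̄_c be its complex conjugate. Then L(1,χ_c)·L(1,χ̄_c) = 2π²/25. -/
open Filter Topology HurwitzZeta

lemma aux_bound (a : ℝ) (ha : 0 < a) (ha' : a ≤ 1 / 2) (s : ℝ) (hs : 1 ≤ s) (hs' : s ≤ 2) (n : ℕ) :
    |(1 / ((n : ℝ) + a) ^ s - 1 / ((n : ℝ) + 1 - a) ^ s) / 2|
      ≤ (1 + 1 / a) * (1 / |(n : ℝ) + a| ^ (2 : ℝ)) := by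
  have hn : (0 : ℝ) ≤ n := Nat.cast_nonneg n
  obtain ⟨u, hu⟩ : ∃ u, u = (n : ℝ) + a := ⟨_, rfl⟩
  obtain ⟨v, hv⟩ : ∃ v, v = (n : ℝ) + 1 - a := ⟨_, rfl⟩
  rw [← hu, ← hv]
  have hu0 : 0 < u := by linarith
  have huv : u ≤ v := by linarith
  have hv0 : 0 < v := by linarith
  have hau : a ≤ u := by linarith
  have hvu : v ≤ u + 1 := by linarith
  have hr : (u / v) ^ (2 : ℝ) ≤ (u / v) ^ s :=
    Real.rpow_le_rpow_of_exponent_ge (by positivity) ((div_le_one hv0).2 huv) hs'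
  have hr1 : (u / v) ^ s ≤ 1 :=
    Real.rpow_le_one (by positivity) ((div_le_one hv0).2 huv) (by linarith)
  rw [Real.rpow_two] at hr
  have e : 1 / u ^ s - 1 / v ^ s = 1 / u ^ s * (1 - (u / v) ^ s) := by
    rw [Real.div_rpow hu0.le hv0.le]
    have := (Real.rpow_pos_of_pos hu0 s).ne'
    have := (Real.rpow_pos_of_pos hv0 s).ne'
    field_simp
  have h1 : 1 / u ^ s ≤ 1 / u + 1 / u ^ 2 := by
    rcases le_total 1 u with h | h
    · have := Real.rpow_le_rpow_of_exponent_le h hs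
      rw [Real.rpow_one] at this
      have h2 := one_div_le_one_div_of_le hu0 this
      have : 0 ≤ 1 / u ^ 2 := by positivity
      linarith
    · have := Real.rpow_le_rpow_of_exponent_ge hu0 h hs'
      rw [Real.rpow_two] at this
      have h2 := one_div_le_one_div_of_le (by positivity) this
      have : 0 ≤ 1 / u := by positivity
      linarith
  have h2 : 1 - (u / v) ^ s ≤ 2 / u := by
    have h3 : 1 - u / v ≤ 1 / u := by
      rw [one_sub_div hv0.ne', div_le_div_iff₀ hv0 hu0]
      nlinarith
    have h4 : 2 / u = 2 * (1 / u) := by ring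
    nlinarith [sq_nonneg (1 - u / v)]
  have hp : 0 ≤ 1 / u ^ s := by positivity
  rw [e, abs_of_nonneg (by have := mul_nonneg hp (sub_nonneg.2 hr1); linarith), abs_of_pos hu0,
    Real.rpow_two]
  have h5 : 1 / u ^ s * (1 - (u / v) ^ s) ≤ (1 / u + 1 / u ^ 2) * (2 / u) :=
    mul_le_mul h1 h2 (sub_nonneg.2 hr1) (by positivity)
  have h6 : 1 / u ≤ 1 / a := one_div_le_one_div_of_le ha hau
  have h7 : (1 / u + 1 / u ^ 2) * (2 / u) = 2 * ((1 + 1 / u) * (1 / u ^ 2)) := by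
    field_simp
  have h8 : (1 + 1 / u) * (1 / u ^ 2) ≤ (1 + 1 / a) * (1 / u ^ 2) := by gcongr
  linarith

lemma aux_summable (a : ℝ) :
    Summable fun n : ℕ => (1 + 1 / a) * (1 / |(n : ℝ) + a| ^ (2 : ℝ)) :=
  ((Real.summable_one_div_nat_add_rpow a 2).2 (by norm_num)).mul_left _

lemma aux_tsum_one (a : ℝ) (ha : 0 < a) (ha' : a ≤ 1 / 2) :
    ∑' n : ℕ, (1 / ((n : ℝ) + a) ^ (1 : ℝ) - 1 / ((n : ℝ) + 1 - a) ^ (1 : ℝ)) / 2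
      = Real.pi / 2 * (Real.cos (Real.pi * a) / Real.sin (Real.pi * a)) := by
  have hsum : Summable fun n : ℕ =>
      (1 / ((n : ℝ) + a) ^ (1 : ℝ) - 1 / ((n : ℝ) + 1 - a) ^ (1 : ℝ)) / 2 :=
    Summable.of_norm_bounded (aux_summable a)
      fun n => aux_bound a ha ha' 1 le_rfl (by norm_num) n
  have ht := hsum.hasSum.tendsto_sum_nat
  have hz : (a : ℂ) ∈ Complex.integerComplement := by
    rintro ⟨m, hm⟩
    have hm' : (m : ℝ) = a := by exact_mod_cast hm
    have h1 : (0 : ℝ) < m := by linarith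
    have h2 : (m : ℝ) < 1 := by linarith
    have h1' : 0 < m := by exact_mod_cast h1
    have h2' : m < 1 := by exact_mod_cast h2
    omega
  have hc := tendsto_logDeriv_euler_cot_sub hz
  have hpart : ∀ N : ℕ, (((∑ n ∈ Finset.range N,
      (1 / ((n : ℝ) + a) ^ (1 : ℝ) - 1 / ((n : ℝ) + 1 - a) ^ (1 : ℝ)) / 2 : ℝ)) : ℂ)
      = (1 / (a : ℂ) + ∑ j ∈ Finset.range N, cotTerm (a : ℂ) j - ((1 / ((N : ℝ) + a) : ℝ) : ℂ)) / 2 := by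
    intro N
    induction N with
    | zero => simp
    | succ N ih =>
      rw [Finset.sum_range_succ, Finset.sum_range_succ, Complex.ofReal_add, ih]
      simp only [cotTerm, Real.rpow_one]
      have h1 : (a : ℂ) - (N + 1) = -(N + 1 - a) := by ring
      have h2 : (a : ℂ) + (N + 1) = N + 1 + a := by ring
      push_cast
      rw [h1, h2, div_neg]
      ring
  have h0 : Tendsto (fun N : ℕ => ((1 / ((N : ℝ) + a) : ℝ) : ℂ)) atTop (𝓝 ((0 : ℝ) : ℂ)) := by
    refine (Complex.continuous_ofReal.tendsto 0).comp ?_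
    simp only [one_div]
    exact tendsto_inv_atTop_zero.comp (tendsto_atTop_add_const_right _ _ tendsto_natCast_atTop_atTop)
  have hR := ((hc.const_add (1 / (a : ℂ))).sub h0).div_const 2
  have hL := (Complex.continuous_ofReal.tendsto _).comp ht
  have := tendsto_nhds_unique (hL.congr hpart) hR
  apply Complex.ofReal_injective
  rw [this]
  simp only [Complex.cot]
  push_cast
  ring

lemma hurwitzOdd_one (a : ℝ) (ha : 0 < a) (ha' : a ≤ 1 / 2) :
    hurwitzZetaOdd (a : UnitAddCircle) 1
      = ((Real.pi / 2 * (Real.cos (Real.pi * a) / Real.sin (Real.pi * a)) : ℝ) : ℂ) := by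
  have h1 : Tendsto (fun s : ℝ => ∑' n : ℕ,
      (1 / ((n : ℝ) + a) ^ s - 1 / ((n : ℝ) + 1 - a) ^ s) / 2) (𝓝[>] 1)
      (𝓝 (∑' n : ℕ, (1 / ((n : ℝ) + a) ^ (1 : ℝ) - 1 / ((n : ℝ) + 1 - a) ^ (1 : ℝ)) / 2)) := by
    refine tendsto_tsum_of_dominated_convergence (aux_summable a) ?_ ?_
    · intro n
      have hn : (0 : ℝ) ≤ n := Nat.cast_nonneg n
      have hu : (n : ℝ) + a ≠ 0 := by linarith
      have hv : (n : ℝ) + 1 - a ≠ 0 := by linarith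
      have hu' : 0 < (n : ℝ) + a := by linarith
      have hv' : 0 < (n : ℝ) + 1 - a := by linarith
      refine Tendsto.mono_left ?_ nhdsWithin_le_nhds
      have c1 := (Real.continuous_const_rpow hu).tendsto 1
      have c2 := (Real.continuous_const_rpow hv).tendsto 1
      exact ((tendsto_const_nhds.div c1 (Real.rpow_pos_of_pos hu' _).ne').sub
        (tendsto_const_nhds.div c2 (Real.rpow_pos_of_pos hv' _).ne')).div_const 2
    · filter_upwards [Ioc_mem_nhdsGT (show (1 : ℝ) < 2 by norm_num)] with s hs n
      exact aux_bound a ha ha' s hs.1.le hs.2 n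
  rw [aux_tsum_one a ha ha'] at h1
  have h2 : Tendsto (fun s : ℝ => hurwitzZetaOdd (a : UnitAddCircle) (s : ℂ)) (𝓝[>] 1)
      (𝓝 (hurwitzZetaOdd (a : UnitAddCircle) 1)) := by
    have hc : Continuous fun s : ℝ => hurwitzZetaOdd (a : UnitAddCircle) (s : ℂ) :=
      (differentiable_hurwitzZetaOdd _).continuous.comp Complex.continuous_ofReal
    have := hc.tendsto 1
    rw [Complex.ofReal_one] at this
    exact this.mono_left nhdsWithin_le_nhds
  have h3 := (Complex.continuous_ofReal.tendsto _).comp h1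
  refine tendsto_nhds_unique h2 (h3.congr' ?_)
  filter_upwards [self_mem_nhdsWithin] with s hs
  have := hasSum_nat_hurwitzZetaOdd_of_mem_Icc (a := a) ⟨ha.le, by linarith⟩ (s := (s : ℂ))
    (by simpa using hs)
  rw [← this.tsum_eq, Function.comp, Complex.ofReal_tsum]
  refine tsum_congr fun n => ?_
  have hn : (0 : ℝ) ≤ n := Nat.cast_nonneg n
  push_cast
  rw [Complex.ofReal_cpow (by linarith), Complex.ofReal_cpow (by linarith)]
  push_cast
  rfl

lemma LFunction_one_aux (χ : DirichletCharacter ℂ 5) (h4 : χ 4 = -1) :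
    DirichletCharacter.LFunction χ 1
      = Real.pi / 5 * (((Real.cos (Real.pi / 5) / Real.sin (Real.pi / 5) : ℝ) : ℂ)
        + χ 2 * ((Real.cos (2 * (Real.pi / 5)) / Real.sin (2 * (Real.pi / 5)) : ℝ) : ℂ)) := by
  have hodd : Function.Odd (χ : ZMod 5 → ℂ) := by
    intro x
    have : -x = 4 * x := by
      have : (4 : ZMod 5) = -1 := by decide
      rw [this]; ring
    rw [this, map_mul, h4]; ring
  have h3 : χ 3 = - χ 2 := by rw [← hodd 2]; congr 1
  have e1 : ZMod.toAddCircle (1 : ZMod 5) = ((1 / 5 : ℝ) : UnitAddCircle) := by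
    simpa using ZMod.toAddCircle_natCast (N := 5) 1
  have e2 : ZMod.toAddCircle (2 : ZMod 5) = ((2 / 5 : ℝ) : UnitAddCircle) := by
    simpa using ZMod.toAddCircle_natCast (N := 5) 2
  have e3 : ZMod.toAddCircle (3 : ZMod 5) = -((2 / 5 : ℝ) : UnitAddCircle) := by
    rw [← e2, ← map_neg]; congr 1
  have e4 : ZMod.toAddCircle (4 : ZMod 5) = -((1 / 5 : ℝ) : UnitAddCircle) := by
    rw [← e1, ← map_neg]; congr 1
  have h0 : χ 0 = 0 := χ.map_nonunit (by rw [isUnit_zero_iff]; decide)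
  have hs : ∀ f : ZMod 5 → ℂ, ∑ j : ZMod 5, f j = f 0 + f 1 + f 2 + f 3 + f 4 :=
    fun f => Fin.sum_univ_five f
  rw [DirichletCharacter.LFunction, ZMod.LFunction_def_odd hodd, hs, h0, h3, h4, map_one,
    e1, e2, e3, e4, hurwitzZetaOdd_neg, hurwitzZetaOdd_neg,
    hurwitzOdd_one _ (by norm_num) (by norm_num), hurwitzOdd_one _ (by norm_num) (by norm_num),
    Complex.cpow_neg_one, show Real.pi * (1 / 5) = Real.pi / 5 by ring,
    show Real.pi * (2 / 5) = 2 * (Real.pi / 5) by ring]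
  push_cast
  ring

lemma cot_aux : (Real.cos (Real.pi / 5) / Real.sin (Real.pi / 5)) ^ 2
    + (Real.cos (2 * (Real.pi / 5)) / Real.sin (2 * (Real.pi / 5))) ^ 2 = 2 := by
  have hs : 0 < Real.sin (Real.pi / 5) :=
    Real.sin_pos_of_pos_of_lt_pi (by positivity) (by linarith [Real.pi_pos])
  have hc : 0 < Real.cos (Real.pi / 5) :=
    Real.cos_pos_of_mem_Ioo ⟨by linarith [Real.pi_pos], by linarith [Real.pi_pos]⟩
  have hq : 4 * Real.cos (Real.pi / 5) ^ 2 = 2 * Real.cos (Real.pi / 5) + 1 := by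
    have := Real.quadratic_root_cos_pi_div_five
    linarith
  have hsq := Real.sin_sq_add_cos_sq (Real.pi / 5)
  rw [Real.cos_two_mul, Real.sin_two_mul]
  generalize Real.cos (Real.pi / 5) = c at *
  generalize Real.sin (Real.pi / 5) = s at *
  have hs2 : s ^ 2 = 1 - c ^ 2 := by linarith
  field_simp
  rw [hs2]
  grind

/-- For the Dirichlet character `χ_c` mod 5 determined by `χ_c(2) = i` and its
complex conjugate `χ̄_c`, one has `L(1,χ_c) L(1,χ̄_c) = 2π²/25`. -/
theorem L_one_chi_c_mul_conj (χc χcbar : DirichletCharacter ℂ 5)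
    (hχc : χc 2 = Complex.I)
    (hχcbar : ∀ a : ZMod 5, χcbar a = (starRingEnd ℂ) (χc a)) :
    DirichletCharacter.LFunction χc 1 * DirichletCharacter.LFunction χcbar 1
      = 2 * (Real.pi : ℂ) ^ 2 / 25 := by
  have h4 : χc 4 = -1 := by
    have : (4 : ZMod 5) = 2 * 2 := by decide
    rw [this, map_mul, hχc, Complex.I_mul_I]
  have h4' : χcbar 4 = -1 := by rw [hχcbar, h4]; simp
  have h2' : χcbar 2 = -Complex.I := by rw [hχcbar, hχc, Complex.conj_I]
  rw [LFunction_one_aux _ h4, LFunction_one_aux _ h4', hχc, h2']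
  have := congrArg (Complex.ofReal) cot_aux
  rw [Complex.ofReal_add, Complex.ofReal_pow, Complex.ofReal_pow] at this
  generalize ((Real.cos (Real.pi / 5) / Real.sin (Real.pi / 5) : ℝ) : ℂ) = x at *
  generalize ((Real.cos (2 * (Real.pi / 5)) / Real.sin (2 * (Real.pi / 5)) : ℝ) : ℂ) = y at *
  push_cast at this
  linear_combination ((Real.pi : ℂ) ^ 2 / 25) * this - (Real.pi : ℂ) ^ 2 / 25 * y ^ 2 * Complex.I_sq
end

section
/- For every positive integer n, τ(n) ≡ n·σ₃(n) (mod 7), where σ₃(n) = ∑_{d | n} d³. -/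
open Finset

namespace TauSeven

open UpperHalfPlane hiding I
open Complex Filter Topology ModularForm EisensteinSeries Derivative
open scoped Manifold MatrixGroups

lemma aux_iter {F : ℕ → ℂ → ℂ} {f : ℂ → ℂ} {U : Set ℂ} (hU : IsOpen U)
    (hF : ∀ n, DifferentiableOn ℂ (F n) U)
    (h : TendstoLocallyUniformlyOn F f atTop U) (k : ℕ) :
    (∀ n, DifferentiableOn ℂ (iteratedDeriv k (F n)) U) ∧
    TendstoLocallyUniformlyOn (fun n => iteratedDeriv k (F n)) (iteratedDeriv k f) atTop U := by
  induction k with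
  | zero => simpa using ⟨hF, h⟩
  | succ k ih =>
    simp only [iteratedDeriv_succ]
    exact ⟨fun n => (ih.1 n).deriv hU, ih.2.deriv (Eventually.of_forall ih.1) hU⟩

lemma aux_poly (P : Polynomial ℤ) (n : ℕ) :
    iteratedDeriv n (fun q : ℂ => Polynomial.aeval q P) 0 = (n.factorial : ℂ) * (P.coeff n : ℂ) := by
  have h : ∀ P : Polynomial ℂ, iteratedDeriv n (fun q : ℂ => P.eval q) =
      fun q => (Polynomial.derivative^[n] P).eval q := by
    induction n with
    | zero => intro P; simp
    | succ n ih =>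
      intro P
      rw [iteratedDeriv_succ', Function.iterate_succ_apply, ← ih]
      congr 1
      ext q
      simp
  have h2 : (fun q : ℂ => Polynomial.aeval q P) =
      fun q => (P.map (Int.castRingHom ℂ)).eval q := by
    ext q
    simp [Polynomial.aeval_def, Polynomial.eval_map]
  rw [h2, h]
  simp only
  rw [← Polynomial.coeff_zero_eq_eval_zero, Polynomial.coeff_iterate_derivative]
  simp [Nat.descFactorial_self]

/-- partial products -/
noncomputable def pp (n : ℕ) : Polynomial ℤ :=
  Polynomial.X * ∏ k ∈ Finset.Icc 1 n, ((1 : Polynomial ℤ) - Polynomial.X ^ k) ^ 24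

lemma pp_succ (n : ℕ) : ∃ R : Polynomial ℤ, pp (n + 1) = pp n + Polynomial.X ^ (n + 1) * (Polynomial.X * R) := by
  have h : ((1 : Polynomial ℤ) - Polynomial.X ^ (n+1)) ∣ 1 - 1 := by simp
  have h2 : (Polynomial.X ^ (n+1) : Polynomial ℤ) ∣ (1 - Polynomial.X ^ (n+1)) ^ 24 - 1 := by
    have := sub_dvd_pow_sub_pow ((1 : Polynomial ℤ) - Polynomial.X ^ (n+1)) 1 24
    rw [one_pow] at this
    refine dvd_trans ⟨-1, by ring⟩ this
  obtain ⟨R, hR⟩ := h2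
  refine ⟨(∏ k ∈ Finset.Icc 1 n, ((1 : Polynomial ℤ) - Polynomial.X ^ k) ^ 24) * R, ?_⟩
  rw [pp, pp, Finset.prod_Icc_succ_top (by omega), sub_eq_iff_eq_add.mp hR]
  ring

lemma pp_coeff (n k : ℕ) : (pp (n + k)).coeff n = ramanujanTau n := by
  induction k with
  | zero => rfl
  | succ k ih =>
    obtain ⟨R, hR⟩ := pp_succ (n + k)
    rw [← add_assoc, hR, Polynomial.coeff_add, ih, Polynomial.coeff_X_pow_mul', if_neg (by omega), add_zero]

lemma pp_tendsto : TendstoLocallyUniformlyOn (fun n (q : ℂ) => Polynomial.aeval q (pp n))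
    (fun q ↦ q * ∏' i, (1 - q ^ (i + 1)) ^ 24) atTop (Metric.ball 0 1) := by
  have h1 := multipliableLocallyUniformlyOn_one_sub_pow.hasProdLocallyUniformlyOn
  have h2 : TendstoLocallyUniformlyOn (fun n (q : ℂ) => ∏ i ∈ Finset.range n, (1 - q ^ (i + 1)))
      (fun q => ∏' i, (1 - q ^ (i + 1))) atTop (Metric.ball (0:ℂ) 1) := by
    have := h1.tendstoLocallyUniformlyOn_finsetRange
    simpa using this
  have hc : ContinuousOn (fun q : ℂ => ∏' i, (1 - q ^ (i + 1))) (Metric.ball (0:ℂ) 1) :=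
    differentiableOn_tprod_one_sub_pow.continuousOn
  have h3 : ∀ k : ℕ, TendstoLocallyUniformlyOn (fun n (q : ℂ) => q * (∏ i ∈ Finset.range n, (1 - q ^ (i + 1))) ^ k)
      (fun q => q * (∏' i, (1 - q ^ (i + 1))) ^ k) atTop (Metric.ball (0:ℂ) 1) := by
    intro k
    induction k with
    | zero =>
      simp only [pow_zero, mul_one]
      intro u hu x hx
      exact ⟨Set.univ, Filter.univ_mem, Eventually.of_forall fun n y _ => refl_mem_uniformity hu⟩
    | succ k ih =>
      have := TendstoLocallyUniformlyOn.mul₀ ih h2 (by fun_prop) hc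
      refine (this.congr ?_).congr_right ?_
      · intro n q hq; simp; ring
      · intro q hq; simp; ring
  refine ((h3 24).congr ?_).congr_right ?_
  · intro n q hq
    simp only [pp, map_mul, map_prod, map_pow, map_sub, map_one, Polynomial.aeval_X]
    rw [← Finset.prod_pow, Finset.range_eq_Ico, Finset.prod_Ico_add' (fun k => (1 - q ^ k) ^ 24) 0 n 1]
    rfl
  · intro q hq
    simp only
    rw [(multipliable_one_sub_pow (by simpa using hq)).tprod_pow 24]

lemma delta_coeff (n : ℕ) : (qExpansion 1 ModularForm.discriminant).coeff n = (ramanujanTau n : ℂ) := by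
  rw [qExpansion_coeff]
  have h0 : (0:ℂ) ∈ Metric.ball (0:ℂ) 1 := by simp
  have e1 : iteratedDeriv n (cuspFunction 1 ModularForm.discriminant) 0 =
      iteratedDeriv n (fun q ↦ q * ∏' i, (1 - q ^ (i + 1)) ^ 24) 0 := by
    apply Filter.EventuallyEq.iteratedDeriv_eq
    exact discriminant_cuspFunction_eqOn.eventuallyEq_of_mem (Metric.isOpen_ball.mem_nhds h0)
  have h := (aux_iter Metric.isOpen_ball (fun n => (Polynomial.differentiable_aeval (pp n)).differentiableOn) pp_tendsto n).2.tendsto_at h0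
  have h' : Tendsto (fun k => iteratedDeriv n (fun q : ℂ => Polynomial.aeval q (pp k)) 0) atTop
      (𝓝 ((n.factorial : ℂ) * (ramanujanTau n : ℂ))) := by
    refine tendsto_const_nhds.congr' ?_
    filter_upwards [eventually_ge_atTop n] with k hk
    obtain ⟨j, rfl⟩ := Nat.exists_eq_add_of_le hk
    rw [aux_poly, pp_coeff]
  rw [e1, tendsto_nhds_unique h h']
  field_simp [Nat.factorial_ne_zero]


/-- q d/dq on power series -/
noncomputable def th {R : Type*} [CommRing R] (f : PowerSeries R) : PowerSeries R :=
  PowerSeries.mk fun n => (n : R) * f.coeff n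

lemma D_hasSum {k : ℤ} (f : ModularForm 𝒮ℒ k) (τ : ℍ) :
    HasSum (fun m : ℕ ↦ (th (qExpansion 1 f)).coeff m • Function.Periodic.qParam 1 τ ^ m)
      (normalizedDerivOfComplex f τ) := by
  set F := cuspFunction 1 f with hFdef
  have hF : DifferentiableOn ℂ F (Metric.ball 0 1) := fun q hq =>
    (ModularFormClass.differentiableAt_cuspFunction f one_pos one_mem_strictPeriods_SL
      (by simpa using hq)).differentiableWithinAt
  have hq : Function.Periodic.qParam 1 (τ : ℂ) ∈ Metric.ball (0:ℂ) 1 := by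
    simpa using Function.Periodic.norm_qParam_lt_one one_pos τ.im_pos
  have hD : normalizedDerivOfComplex f τ =
      Function.Periodic.qParam 1 (τ : ℂ) * deriv F (Function.Periodic.qParam 1 (τ : ℂ)) := by
    have h1 : (f ∘ ofComplex) =ᶠ[𝓝 (τ : ℂ)] fun z => F (Function.Periodic.qParam 1 z) := by
      filter_upwards [isOpen_upperHalfPlaneSet.mem_nhds τ.im_pos] with z hz
      have := SlashInvariantFormClass.eq_cuspFunction f ⟨z, hz⟩ one_mem_strictPeriods_SL one_ne_zero
      simp only [Function.comp_apply, ofComplex_apply_of_im_pos hz]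
      exact this.symm
    have h2 : HasDerivAt (Function.Periodic.qParam 1)
        (2 * Real.pi * I * Function.Periodic.qParam 1 (τ : ℂ)) (τ : ℂ) := by
      have h3 : HasDerivAt (fun z : ℂ => 2 * Real.pi * I * z / (1:ℝ)) (2 * Real.pi * I) (τ : ℂ) := by
        simpa using (hasDerivAt_id (τ : ℂ)).const_mul (2 * Real.pi * I)
      have := h3.cexp
      rw [mul_comm (2 * Real.pi * I : ℂ)]
      exact this
    have h4 := ((hF.differentiableAt (Metric.isOpen_ball.mem_nhds hq)).hasDerivAt.comp (τ : ℂ) h2).deriv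
    rw [normalizedDerivOfComplex, h1.deriv_eq]
    change _ * deriv (F ∘ Function.Periodic.qParam 1) _ = _
    rw [h4]
    have : (2 * Real.pi * I : ℂ) ≠ 0 := two_pi_I_ne_zero
    field_simp
  have hT := hasSum_taylorSeries_on_ball (hF.deriv Metric.isOpen_ball) hq
  have hT2 := hT.mul_left (Function.Periodic.qParam 1 (τ : ℂ))
  rw [← hD] at hT2
  rw [← hasSum_nat_add_iff' 1]
  simp only [Finset.range_one, Finset.sum_singleton]
  have hz : (th (qExpansion 1 f)).coeff 0 = 0 := by simp [th]
  rw [hz, zero_smul, sub_zero]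
  refine hT2.congr_fun ?_
  intro m
  have : ((m+1).factorial : ℂ) ≠ 0 := by exact_mod_cast Nat.factorial_ne_zero _
  have h' : (m.factorial : ℂ) ≠ 0 := by exact_mod_cast Nat.factorial_ne_zero _
  simp only [th, PowerSeries.coeff_mk, qExpansion_coeff, ← hFdef, iteratedDeriv_succ', smul_eq_mul, sub_zero]
  rw [Nat.factorial_succ]
  push_cast
  have h1 : (m : ℂ) + 1 ≠ 0 := by exact_mod_cast Nat.succ_ne_zero m
  field_simp
  ring

lemma D_mdiff {k : ℤ} (f : ModularForm 𝒮ℒ k) : MDiff (normalizedDerivOfComplex f) :=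
  normalizedDerivOfComplex_mdifferentiable f.holo'

lemma D_bdd {k : ℤ} (f : ModularForm 𝒮ℒ k) : IsBoundedAtImInfty (normalizedDerivOfComplex f) :=
  isBoundedAtImInfty_of_hasSum_qExpansion one_pos (D_hasSum f)

lemma D_per {k : ℤ} (f : ModularForm 𝒮ℒ k) :
    Function.Periodic (normalizedDerivOfComplex f ∘ ofComplex) (1 : ℝ) := by
  intro w
  by_cases! hw : 0 < im w
  · have h1 : 0 < im (w + (1:ℝ)) := by simpa using hw
    simp only [Function.comp_apply, ofComplex_apply_of_im_pos h1, ofComplex_apply_of_im_pos hw]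
    have e1 := D_hasSum f ⟨w + (1:ℝ), h1⟩
    have e2 := D_hasSum f ⟨w, hw⟩
    have hp : Function.Periodic.qParam 1 (w + (1:ℝ)) = Function.Periodic.qParam 1 w := by
      simp only [Function.Periodic.qParam, Complex.ofReal_one, div_one, mul_add, mul_one,
        Complex.exp_add, Complex.exp_two_pi_mul_I]
    have e3 : HasSum (fun m : ℕ ↦ (th (qExpansion 1 f)).coeff m • Function.Periodic.qParam 1 w ^ m)
      (normalizedDerivOfComplex f ⟨w + (1:ℝ), h1⟩) := by
      rw [← hp]; exact e1
    exact e3.unique e2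
  · have : im (w + (1:ℝ)) ≤ 0 := by simpa using hw
    simp only [Function.comp_apply, ofComplex_apply_of_im_nonpos this, ofComplex_apply_of_im_nonpos hw]

lemma D_an {k : ℤ} (f : ModularForm 𝒮ℒ k) :
    AnalyticAt ℂ (cuspFunction 1 (normalizedDerivOfComplex f)) 0 :=
  analyticAt_cuspFunction_zero one_pos (D_per f) (D_mdiff f) (D_bdd f)

lemma D_qexp {k : ℤ} (f : ModularForm 𝒮ℒ k) :
    qExpansion 1 (normalizedDerivOfComplex f) = th (qExpansion 1 f) := by
  ext m
  have h1 := (hasFPowerSeriesOnBall_cuspFunction (h := 1)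
    (c := fun m => (th (qExpansion 1 f)).coeff m) one_pos (D_an f) (D_hasSum f)).hasFPowerSeriesAt
  have h2 := (D_an f).hasFPowerSeriesAt
  have h3 := congr_arg (FormalMultilinearSeries.coeff · m) (h1.eq_formalMultilinearSeries h2)
  simp only [FormalMultilinearSeries.coeff_ofScalars] at h3
  rw [h3, qExpansion_coeff]
  ring

/-- The first Rankin-Cohen bracket of `E₄` and `E₆`. -/
noncomputable def br : ℍ → ℂ :=
  (4 : ℂ) • (E₄ * normalizedDerivOfComplex E₆) - (6 : ℂ) • (E₆ * normalizedDerivOfComplex E₄)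

lemma br_slash (γ : SL(2, ℤ)) : br ∣[(12 : ℤ)] γ = br := by
  have hγ : (γ : GL (Fin 2) ℝ) ∈ 𝒮ℒ := ⟨γ, rfl⟩
  have s4 : (E₄ : ℍ → ℂ) ∣[(4:ℤ)] γ = E₄ := by
    rw [SL_slash]; exact SlashInvariantForm.slash_action_eqn E₄ _ hγ
  have s6 : (E₆ : ℍ → ℂ) ∣[(6:ℤ)] γ = E₆ := by
    rw [SL_slash]; exact SlashInvariantForm.slash_action_eqn E₆ _ hγ
  have d4 := serreDerivative_slash_invariant E₄.holo' s4
  have d6 := serreDerivative_slash_invariant E₆.holo' s6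
  have hbr : br = (4 : ℂ) • (E₄ * serreDerivative (6:ℤ) E₆) +
      (-6 : ℂ) • (E₆ * serreDerivative (4:ℤ) E₄) := by
    ext z
    simp [br]
    ring
  have m1 : ((E₄ : ℍ → ℂ) * serreDerivative (6:ℤ) E₆) ∣[(12 : ℤ)] γ =
      (E₄ : ℍ → ℂ) * serreDerivative (6:ℤ) E₆ := by
    have := mul_slash_SL2 4 (6+2) γ E₄ (serreDerivative (6:ℤ) E₆)
    rw [s4] at this
    erw [d6] at this
    exact this
  have m2 : ((E₆ : ℍ → ℂ) * serreDerivative (4:ℤ) E₄) ∣[(12 : ℤ)] γ =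
      (E₆ : ℍ → ℂ) * serreDerivative (4:ℤ) E₄ := by
    have := mul_slash_SL2 6 (4+2) γ E₆ (serreDerivative (4:ℤ) E₄)
    rw [s6] at this
    erw [d4] at this
    exact this
  rw [hbr, SlashAction.add_slash, SL_smul_slash, SL_smul_slash, m1, m2]

lemma an_mf {k : ℤ} (f : ModularForm 𝒮ℒ k) : AnalyticAt ℂ (cuspFunction 1 f) 0 :=
  ModularFormClass.analyticAt_cuspFunction_zero f one_pos one_mem_strictPeriods_SL

lemma bdd_mf {k : ℤ} (f : ModularForm 𝒮ℒ k) : IsBoundedAtImInfty f :=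
  haveI : Fact (IsCusp OnePoint.infty 𝒮ℒ) := ⟨Subgroup.isCusp_of_mem_strictPeriods one_pos one_mem_strictPeriods_SL⟩
  ModularFormClass.bdd_at_infty f

lemma br_bdd : IsBoundedAtImInfty br := by
  have h1 := ((bdd_mf E₄).mul (D_bdd E₆)).const_smul_left (4:ℂ)
  have h2 := ((bdd_mf E₆).mul (D_bdd E₄)).const_smul_left (6:ℂ)
  exact Asymptotics.IsBigO.sub h1 h2

/-- The bracket as a modular form -/
noncomputable def brMF : ModularForm 𝒮ℒ 12 where
  toFun := br
  slash_action_eq' A hA := by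
    obtain ⟨A, rfl⟩ := hA
    exact br_slash A
  holo' := by
    have h1 := E₄.holo'.mul (D_mdiff E₆)
    have h2 := E₆.holo'.mul (D_mdiff E₄)
    exact (h1.const_smul (4:ℂ)).sub (h2.const_smul (6:ℂ))
  bdd_at_cusps' hc := by
    rw [Subgroup.IsArithmetic.isCusp_iff_isCusp_SL2Z] at hc
    rw [OnePoint.isBoundedAt_iff_forall_SL2Z hc]
    intro γ _
    rw [br_slash]
    exact br_bdd

lemma an_br1 {k l : ℤ} (f : ModularForm 𝒮ℒ k) (g : ModularForm 𝒮ℒ l) :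
    AnalyticAt ℂ (cuspFunction 1 (f * normalizedDerivOfComplex g)) 0 := by
  rw [cuspFunction_mul (an_mf f).continuousAt (D_an g).continuousAt]
  exact (an_mf f).mul (D_an g)

lemma an_br2 {k l : ℤ} (c : ℂ) (f : ModularForm 𝒮ℒ k) (g : ModularForm 𝒮ℒ l) :
    AnalyticAt ℂ (cuspFunction 1 (c • (f * normalizedDerivOfComplex g))) 0 := by
  rw [cuspFunction_smul (an_br1 f g).continuousAt]
  exact (an_br1 f g).const_smul

lemma br_qexp : qExpansion 1 brMF =
    (4 : ℂ) • (qExpansion 1 E₄ * th (qExpansion 1 E₆)) -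
    (6 : ℂ) • (qExpansion 1 E₆ * th (qExpansion 1 E₄)) := by
  change qExpansion 1 br = _
  rw [br, qExpansion_sub (an_br2 4 E₄ E₆) (an_br2 6 E₆ E₄),
    qExpansion_smul (an_br1 E₄ E₆), qExpansion_smul (an_br1 E₆ E₄),
    qExpansion_mul (an_mf E₄) (D_an E₆), qExpansion_mul (an_mf E₆) (D_an E₄), D_qexp, D_qexp]

lemma E4_coeff (m : ℕ) : (qExpansion 1 E₄).coeff m =
    if m = 0 then 1 else 240 * (ArithmeticFunction.sigma 3 m : ℂ) := by
  norm_num [E_qExpansion_coeff _ ⟨2, rfl⟩, show bernoulli 4 = -1 / 30 by decide +kernel]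

lemma E6_coeff (m : ℕ) : (qExpansion 1 E₆).coeff m =
    if m = 0 then 1 else -504 * (ArithmeticFunction.sigma 5 m : ℂ) := by
  norm_num [E_qExpansion_coeff _ ⟨3, rfl⟩, show bernoulli 6 = 1 / 42 by decide +kernel]

lemma key_C : (4 : ℂ) • (qExpansion 1 E₄ * th (qExpansion 1 E₆)) -
    (6 : ℂ) • (qExpansion 1 E₆ * th (qExpansion 1 E₄)) =
    (-3456 : ℂ) • qExpansion 1 ModularForm.discriminant := by
  let Δ : ModularForm 𝒮ℒ 12 := CuspForm.toModularFormₗ CuspForm.discriminant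
  have hΔ : qExpansion 1 Δ = qExpansion 1 ModularForm.discriminant := rfl
  have hq : qExpansion 1 (brMF - (-3456 : ℂ) • Δ : ModularForm 𝒮ℒ 12) = (4 : ℂ) • (qExpansion 1 E₄ * th (qExpansion 1 E₆)) -
    (6 : ℂ) • (qExpansion 1 E₆ * th (qExpansion 1 E₄)) -
    (-3456 : ℂ) • qExpansion 1 ModularForm.discriminant := by
    rw [← br_qexp, ← hΔ]
    have e1 := ModularForm.qExpansion_sub one_pos one_mem_strictPeriods_SL brMF ((-3456 : ℂ) • Δ)
    have e2 := ModularForm.qExpansion_smul one_pos one_mem_strictPeriods_SL (-3456 : ℂ) Δ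
    rw [← e2]
    exact e1
  have t0 : (qExpansion 1 ModularForm.discriminant).coeff 0 = 0 := by
    rw [delta_coeff]; simp [ramanujanTau]
  have t1 : (qExpansion 1 ModularForm.discriminant).coeff 1 = 1 := by
    rw [delta_coeff]; simp [ramanujanTau, Polynomial.coeff_X_mul, Polynomial.coeff_zero_eq_eval_zero]
  have hz : brMF - (-3456 : ℂ) • Δ = 0 := by
    apply sturm_bound_levelOne (k := 12)
    rw [hq]
    refine lt_of_lt_of_le (b := ((2 : ℕ) : ℕ∞)) (by exact_mod_cast (by decide : Int.toNat 12 / 12 < 2)) (PowerSeries.nat_le_order _ _ ?_)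
    intro i hi
    interval_cases i
    · simp only [map_sub, PowerSeries.coeff_smul, t0]
      simp [th]
    · simp [PowerSeries.coeff_mul, th, t1, Finset.Nat.antidiagonal_succ, E4_coeff, E6_coeff]
      norm_num
  rw [hz] at hq
  exact sub_eq_zero.mp (hq.symm.trans (qExpansion_zero 1))

/-- integral versions -/
noncomputable def AZ : PowerSeries ℤ :=
  PowerSeries.mk fun m => if m = 0 then 1 else 240 * (ArithmeticFunction.sigma 3 m : ℤ)

/-- integral versions -/
noncomputable def BZ : PowerSeries ℤ :=
  PowerSeries.mk fun m => if m = 0 then 1 else -504 * (ArithmeticFunction.sigma 5 m : ℤ)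

lemma th_map {R S : Type*} [CommRing R] [CommRing S] (φ : R →+* S) (f : PowerSeries R) :
    PowerSeries.map φ (th f) = th (PowerSeries.map φ f) := by
  ext n; simp [th]

lemma key_Z : 4 * (AZ * th BZ) - 6 * (BZ * th AZ) = -3456 * PowerSeries.mk ramanujanTau := by
  have hA : PowerSeries.map (Int.castRingHom ℂ) AZ = qExpansion 1 E₄ := by
    ext m; rw [E4_coeff]; simp only [AZ, PowerSeries.coeff_map, PowerSeries.coeff_mk]
    split_ifs <;> simp
  have hB : PowerSeries.map (Int.castRingHom ℂ) BZ = qExpansion 1 E₆ := by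
    ext m; rw [E6_coeff]; simp only [BZ, PowerSeries.coeff_map, PowerSeries.coeff_mk]
    split_ifs <;> simp
  have hT : PowerSeries.map (Int.castRingHom ℂ) (PowerSeries.mk ramanujanTau) =
      qExpansion 1 ModularForm.discriminant := by
    ext m; rw [delta_coeff]; simp
  apply PowerSeries.map_injective (Int.castRingHom ℂ) (RingHom.injective_int _)
  have := key_C
  simp only [PowerSeries.smul_eq_C_mul] at this
  simp only [map_sub, map_mul, map_neg, map_ofNat, th_map, hA, hB, hT] at this ⊢
  exact this

lemma key_7 (n : ℕ) (hn : n ≠ 0) :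
    (ramanujanTau n : ZMod 7) = n * (ArithmeticFunction.sigma 3 n : ZMod 7) := by
  have h504 : (504 : ZMod 7) = 0 := by decide
  have hB : PowerSeries.map (Int.castRingHom (ZMod 7)) BZ = 1 := by
    ext m
    simp only [BZ, PowerSeries.coeff_map, PowerSeries.coeff_mk, PowerSeries.coeff_one]
    split_ifs <;> simp [h504]
  have h1 : th (1 : PowerSeries (ZMod 7)) = 0 := by
    ext m; by_cases h : m = 0 <;> simp [th, PowerSeries.coeff_one, h]
  have := congrArg (PowerSeries.map (Int.castRingHom (ZMod 7))) key_Z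
  simp only [map_sub, map_mul, map_neg, map_ofNat, th_map, hB, h1] at this
  rw [← th_map] at this
  have h2 := congrArg (PowerSeries.coeff n) this
  have c6 : (6 : PowerSeries (ZMod 7)) = PowerSeries.C 6 := (map_ofNat _ 6).symm
  have c3 : (-3456 : PowerSeries (ZMod 7)) = PowerSeries.C (-3456) := by
    rw [map_neg, map_ofNat]
  rw [c6, c3] at h2
  simp only [mul_zero, zero_sub, one_mul, map_neg, PowerSeries.coeff_C_mul, PowerSeries.coeff_map,
    th, AZ, PowerSeries.coeff_mk, if_neg hn] at h2
  have e1 : (240 : ZMod 7) = 2 := by decide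
  have e2 : (3456 : ZMod 7) = -2 := by decide
  have e3 : (6 : ZMod 7) = -1 := by decide
  have e4 : (4 : ZMod 7) * 2 = 1 := by decide
  simp [e1, e2, e3] at h2
  linear_combination (-4) * h2 + ((n : ZMod 7) * (ArithmeticFunction.sigma 3 n : ZMod 7) - (ramanujanTau n : ZMod 7)) * e4

end TauSeven

/-- `τ(n) ≡ n σ₃(n) (mod 7)`. -/
theorem tau_congruent_mod_seven (n : ℕ) (hn : 1 ≤ n) :
    ramanujanTau n ≡ (n : ℤ) * (ArithmeticFunction.sigma 3 n : ℤ) [ZMOD 7] := by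
  have h := TauSeven.key_7 n (by omega)
  apply (ZMod.intCast_eq_intCast_iff _ _ 7).mp
  push_cast
  exact h
end

section
/- Define t_n = 1 if 3 ∤ τ(n) and t_n = 0 otherwise, and let T(s) = ∑_{n=1}^∞ t_n·n^{-s}. Let χ₋₃ be the quadratic Dirichlet character modulo 3 (the Kronecker character of ℚ(√−3)). Then for real s > 1, T(s)² = ζ(s)·L(s,χ₋₃)·(1 − 3^{-s}) · ∏_{p ≡ 2 (mod 3)} (1 − p^{-2s})^{-1} · ∏_{p ≡ 1 (mod 3)} ((1 − p^{-2s})/(1 − p^{-3s}))², products over primes in the indicated residue classes. -/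
open Finset

/-- `t n = 1` if `3 ∤ τ(n)`, and `t n = 0` otherwise. -/
noncomputable def t3 (n : ℕ) : ℝ := if (3 : ℤ) ∣ ramanujanTau n then 0 else 1


section PartA
open Polynomial Filter Topology UpperHalfPlane ModularForm

noncomputable def tauPoly (N : ℕ) : ℂ[X] :=
  X * (∏ k ∈ Finset.range N, ((1 : ℂ[X]) - X ^ (k + 1))) ^ 24

lemma tauPoly_succ_coeff (N n : ℕ) (h : n ≤ N) :
    (tauPoly (N + 1)).coeff n = (tauPoly N).coeff n := by
  unfold tauPoly
  rw [Finset.prod_range_succ, mul_pow]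
  obtain ⟨r, hr⟩ : (X : ℂ[X]) ^ (N + 1) ∣ (1 - X ^ (N + 1)) ^ 24 - 1 := by
    have := sub_dvd_pow_sub_pow ((1 : ℂ[X]) - X ^ (N + 1)) 1 24
    rw [one_pow] at this
    refine dvd_trans ?_ this
    exact ⟨-1, by ring⟩
  have h2 : (1 - (X : ℂ[X]) ^ (N + 1)) ^ 24 = 1 + X ^ (N + 1) * r := by
    linear_combination hr
  rw [h2]
  have : X * ((∏ k ∈ Finset.range N, ((1 : ℂ[X]) - X ^ (k + 1))) ^ 24 * (1 + X ^ (N + 1) * r))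
     = X * (∏ k ∈ Finset.range N, ((1 : ℂ[X]) - X ^ (k + 1))) ^ 24 +
       X ^ (N + 1) * (X * r * (∏ k ∈ Finset.range N, ((1 : ℂ[X]) - X ^ (k + 1))) ^ 24) := by ring
  rw [this, coeff_add, coeff_X_pow_mul', if_neg (by omega), add_zero]

lemma tauPoly_coeff (N n : ℕ) (h : n ≤ N) :
    (tauPoly N).coeff n = (ramanujanTau n : ℂ) := by
  induction N, h using Nat.le_induction with
  | base =>
    have : tauPoly n = (Polynomial.X * ∏ k ∈ Finset.Icc 1 n,
        ((1 : Polynomial ℤ) - Polynomial.X ^ k) ^ 24).map (Int.castRingHom ℂ) := by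
      rw [tauPoly, Finset.prod_pow, Finset.range_eq_Ico,
        Finset.prod_Ico_add' (fun k => (1 : ℂ[X]) - X ^ k) 0 n 1]
      simp [Polynomial.map_prod]
      rfl
    rw [this, coeff_map, ramanujanTau]
    simp
  | succ N hN ih => rw [tauPoly_succ_coeff _ _ hN, ih]

lemma iter_deriv_tendsto (P : ℕ → ℂ[X]) (f : ℂ → ℂ)
    (h : TendstoLocallyUniformlyOn (fun N q => (P N).eval q) f atTop (Metric.ball (0 : ℂ) 1))
    (n : ℕ) : TendstoLocallyUniformlyOn (fun N q => (derivative^[n] (P N)).eval q)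
      (iteratedDeriv n f) atTop (Metric.ball (0 : ℂ) 1) := by
  induction n with
  | zero => simpa using h
  | succ n ih =>
    have := ih.deriv (.of_forall fun N => (Polynomial.differentiable _).differentiableOn)
      Metric.isOpen_ball
    rw [iteratedDeriv_succ]
    convert this using 2 with N
    ext q
    simp [Function.iterate_succ_apply']

lemma tlu_const (g : ℂ → ℂ) : TendstoLocallyUniformlyOn (fun (_ : ℕ) => g) g atTop
    (Metric.ball (0 : ℂ) 1) := by
  intro u hu x hx
  exact ⟨Set.univ, univ_mem, .of_forall fun n y _ => refl_mem_uniformity hu⟩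

lemma delta_tendsto : TendstoLocallyUniformlyOn (fun N q => (tauPoly N).eval q)
    (fun q ↦ q * ∏' i, (1 - q ^ (i + 1)) ^ 24) atTop (Metric.ball (0 : ℂ) 1) := by
  have h1 : TendstoLocallyUniformlyOn
      (fun (N : ℕ) (q : ℂ) => ∏ k ∈ Finset.range N, (1 - q ^ (k + 1)))
      (fun q ↦ ∏' i, (1 - q ^ (i + 1))) atTop (Metric.ball (0 : ℂ) 1) := by
    have := (hasProdLocallyUniformlyOn_iff_tendstoLocallyUniformlyOn.mp
      multipliableLocallyUniformlyOn_one_sub_pow.hasProdLocallyUniformlyOn)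
    intro u hu x hx
    obtain ⟨t, ht, h⟩ := this u hu x hx
    refine ⟨t, ht, ?_⟩
    have := tendsto_finset_range.eventually h
    simpa using this
  have hc : ContinuousOn (fun q : ℂ ↦ ∏' i, (1 - q ^ (i + 1))) (Metric.ball (0 : ℂ) 1) :=
    differentiableOn_tprod_one_sub_pow.continuousOn
  have h2 : ∀ k : ℕ, TendstoLocallyUniformlyOn
      (fun (N : ℕ) (q : ℂ) => (∏ k ∈ Finset.range N, (1 - q ^ (k + 1))) ^ k)
      (fun q ↦ (∏' i, (1 - q ^ (i + 1))) ^ k) atTop (Metric.ball (0 : ℂ) 1) := by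
    intro k
    induction k with
    | zero =>
      simp only [pow_zero]
      exact (tlu_const _)
    | succ k ih =>
      simp only [pow_succ]
      exact ih.mul₀ h1 (hc.pow k) hc
  have h3 : TendstoLocallyUniformlyOn (fun (_ : ℕ) (q : ℂ) => q) (fun q => q) atTop
    (Metric.ball (0 : ℂ) 1) := (tlu_const _)
  have h4 := h3.mul₀ (h2 24) continuousOn_id (hc.pow 24)
  refine (h4.congr_right ?_).congr ?_
  · intro q hq
    simp only [Pi.mul_apply]
    rw [(multipliable_one_sub_pow (by simpa using hq)).tprod_pow 24]
  · intro N q hq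
    simp [tauPoly, eval_prod]

lemma delta_coeff (n : ℕ) :
    (qExpansion 1 ModularForm.discriminant).coeff n = (ramanujanTau n : ℂ) := by
  rw [qExpansion_coeff]
  have h0 : (0 : ℂ) ∈ Metric.ball (0 : ℂ) 1 := Metric.mem_ball_self one_pos
  have he : cuspFunction 1 ModularForm.discriminant =ᶠ[𝓝 0]
      (fun q ↦ q * ∏' i, (1 - q ^ (i + 1)) ^ 24) :=
    discriminant_cuspFunction_eqOn.eventuallyEq_of_mem (Metric.isOpen_ball.mem_nhds h0)
  rw [he.iteratedDeriv_eq]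
  have ht := (iter_deriv_tendsto _ _ delta_tendsto n).tendsto_at h0
  have hconst : Tendsto (fun N => (derivative^[n] (tauPoly N)).eval 0) atTop
      (𝓝 ((n.factorial : ℂ) * ramanujanTau n)) := by
    refine tendsto_const_nhds.congr' ?_
    filter_upwards [eventually_ge_atTop n] with N hN
    rw [← coeff_zero_eq_eval_zero, coeff_iterate_derivative]
    simp [tauPoly_coeff N n hN, Nat.descFactorial_self]
  rw [tendsto_nhds_unique ht hconst]
  field_simp [Nat.factorial_ne_zero]
end PartA

section PartB
open UpperHalfPlane ModularForm ModularFormClass MatrixGroups EisensteinSeries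

noncomputable def sigSer (k : ℕ) : PowerSeries ℤ :=
  PowerSeries.mk fun n => (ArithmeticFunction.sigma k n : ℤ)

noncomputable def tauSer : PowerSeries ℤ := PowerSeries.mk ramanujanTau

noncomputable def toC : PowerSeries ℤ →+* PowerSeries ℂ := PowerSeries.map (Int.castRingHom ℂ)

lemma toC_inj : Function.Injective toC := by
  intro a b h
  ext n
  have := congrArg (PowerSeries.coeff n) h
  simpa [toC] using this

lemma toC_sigSer_coeff (k n : ℕ) :
    (toC (sigSer k)).coeff n = (ArithmeticFunction.sigma k n : ℂ) := by
  simp [toC, sigSer]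

lemma E_ser {k : ℕ} (hk : 3 ≤ k) (hk2 : Even k) (c : ℤ) (hc : -(2 * k / bernoulli k : ℂ) = c) :
    qExpansion 1 (E hk) = toC (1 + (c : PowerSeries ℤ) * sigSer (k - 1)) := by
  have hC : toC (c : PowerSeries ℤ) = PowerSeries.C (c : ℂ) := by
    rw [map_intCast, map_intCast]
  ext m
  rw [E_qExpansion_coeff hk hk2, hc, map_add, map_mul, map_one, hC, map_add,
    PowerSeries.coeff_C_mul, toC_sigSer_coeff, PowerSeries.coeff_one]
  split_ifs with h
  · simp [h]
  · simp

lemma E4_ser : qExpansion 1 E₄ = toC (1 + 240 * sigSer 3) := by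
  have := E_ser (k := 4) (by norm_num) ⟨2, rfl⟩ 240
    (by norm_num [show bernoulli 4 = -1 / 30 by decide +kernel])
  simpa using this

lemma E6_ser : qExpansion 1 E₆ = toC (1 + (-504) * sigSer 5) := by
  have := E_ser (k := 6) (by norm_num) ⟨3, rfl⟩ (-504)
    (by norm_num [show bernoulli 6 = 1 / 42 by decide +kernel])
  simpa using this

noncomputable abbrev E8' : ModularForm 𝒮ℒ 8 := E (by norm_num : 3 ≤ 8)

lemma E8_ser : qExpansion 1 E8' = toC (1 + 480 * sigSer 7) := by
  have := E_ser (k := 8) (by norm_num) ⟨4, rfl⟩ 480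
    (by norm_num [show bernoulli 8 = -1 / 30 by decide +kernel])
  simpa using this

noncomputable def diff8 : ModularForm 𝒮ℒ 8 := ModularForm.mcast (by decide) (E₄.pow 2) - E8'

lemma diff8_ser : qExpansion 1 diff8 = qExpansion 1 E₄ ^ 2 - qExpansion 1 E8' := by
  simp only [diff8, FunLike.coe_sub, coe_mcast,
    ModularForm.qExpansion_sub one_pos one_mem_strictPeriods_SL,
    ModularForm.qExpansion_pow one_pos one_mem_strictPeriods_SL]

lemma E4_sq : qExpansion 1 E₄ ^ 2 = qExpansion 1 E8' := by
  have hcusp : IsCuspForm diff8 := by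
    rw [isCuspForm_iff_coeffZero_eq_zero, diff8_ser, pow_two]
    simp [PowerSeries.coeff_mul, -PowerSeries.coeff_zero_eq_constantCoeff,
      E_qExpansion_coeff_zero _ ⟨2, rfl⟩, E_qExpansion_coeff_zero _ ⟨4, rfl⟩]
  obtain ⟨g, hg⟩ := hcusp
  have hg0 : g = 0 := rank_zero_iff_forall_zero.mp
    (CuspForm.rank_eq_zero_of_weight_lt_twelve (k := 8) (by norm_num)) g
  have hd : (diff8 : ℍ → ℂ) = 0 := by
    have : (g : ℍ → ℂ) = diff8 := congrArg DFunLike.coe hg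
    rw [← this, hg0]; rfl
  have := diff8_ser
  rw [hd, qExpansion_zero] at this
  exact (sub_eq_zero.mp this.symm)

lemma delta_ser : qExpansion 1 ModularForm.discriminant = toC tauSer := by
  ext n
  rw [delta_coeff]
  simp [toC, tauSer]

noncomputable def form12 : ModularForm 𝒮ℒ 12 :=
  ModularForm.mcast (by decide) (E₄.pow 3) - ModularForm.mcast (by decide) (E₆.pow 2)

lemma form12_ser : qExpansion 1 form12 = qExpansion 1 E₄ ^ 3 - qExpansion 1 E₆ ^ 2 := by
  simp only [form12, FunLike.coe_sub, coe_mcast,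
    ModularForm.qExpansion_sub one_pos one_mem_strictPeriods_SL,
    ModularForm.qExpansion_pow one_pos one_mem_strictPeriods_SL]

lemma delta_id : 1728 * toC tauSer = qExpansion 1 E₄ ^ 3 - qExpansion 1 E₆ ^ 2 := by
  rw [← form12_ser, ← delta_ser]
  have h := ModularForm.qExpansion_smul one_pos one_mem_strictPeriods_SL (1728 : ℂ)
      CuspForm.discriminant
  have h2 : (form12 : ℍ → ℂ) = (1728 : ℂ) • (CuspForm.discriminant : ℍ → ℂ) := by
    ext z
    have : form12 z = E₄ z ^ 3 - E₆ z ^ 2 := by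
      simp only [form12, coe_mcast, ModularForm.coe_pow, sub_apply, Pi.pow_apply]
    rw [this]
    have h3 := discriminant_eq_E₄_cube_sub_E₆_sq z
    simp only [Pi.smul_apply, CuspForm.coe_discriminant, smul_eq_mul, h3]
    ring
  rw [h2, h, CuspForm.coe_discriminant, PowerSeries.smul_eq_C_mul]
  congr 1

lemma id1 : 1728 * tauSer = (1 + 240 * sigSer 3) ^ 3 - (1 + (-504) * sigSer 5) ^ 2 := by
  apply toC_inj
  have := delta_id
  rw [E4_ser, E6_ser] at this
  rw [map_mul, map_sub, map_pow, map_pow, ← this]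
  congr 1
  exact map_ofNat toC 1728

lemma id2 : (1 + 240 * sigSer 3) ^ 2 = 1 + 480 * sigSer 7 := by
  apply toC_inj
  have := E4_sq
  rwa [E4_ser, E8_ser, ← map_pow] at this

lemma id3 : 12 * tauSer = 10 * sigSer 7 + 7 * sigSer 5 - 5 * sigSer 3
    + 96000 * sigSer 3 ^ 3 - 1764 * sigSer 5 ^ 2 := by
  have h : (144 : PowerSeries ℤ) ≠ 0 := by
    intro h
    have := congrArg (PowerSeries.constantCoeff) h
    rw [map_ofNat] at this
    simp at this
  apply mul_left_cancel₀ h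
  linear_combination id1 + 3 * id2

lemma cube_coeff (f : PowerSeries ℤ) (n : ℕ) (hn : ¬ 3 ∣ n) : (3 : ℤ) ∣ (f ^ 3).coeff n := by
  obtain ⟨m, rfl⟩ : ∃ m, n = m + 1 := ⟨n - 1, by have : n ≠ 0 := by (rintro rfl; simp at hn)
                                                 omega⟩
  have h := congrArg (PowerSeries.coeff m) (PowerSeries.derivative_pow f 3)
  have h3 : (3 : PowerSeries ℤ) = PowerSeries.C 3 := by simp
  rw [PowerSeries.coeff_derivative] at h
  have h2 : (3 : ℤ) ∣ (f ^ 3).coeff (m + 1) * (m + 1) := by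
    rw [h]
    push_cast
    rw [mul_assoc, h3, PowerSeries.coeff_C_mul]
    exact ⟨_, rfl⟩
  have hp : Prime (3 : ℤ) := Int.prime_three
  rcases hp.dvd_or_dvd h2 with h | h
  · exact h
  · exfalso; apply hn; exact_mod_cast h

lemma tau_mod (n : ℕ) (hn : ¬ 3 ∣ n) :
    (3 : ℤ) ∣ ramanujanTau n - (ArithmeticFunction.sigma 1 n : ℤ) := by
  have hc : ∀ (a : ℤ) (f : PowerSeries ℤ), ((a : PowerSeries ℤ) * f).coeff n = a * f.coeff n := by
    intro a f
    rw [show (a : PowerSeries ℤ) = PowerSeries.C a by simp, PowerSeries.coeff_C_mul]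
  have h := congrArg (PowerSeries.coeff n) id3
  have e1 := hc 12 tauSer
  have e2 := hc 10 (sigSer 7)
  have e3 := hc 7 (sigSer 5)
  have e4 := hc 5 (sigSer 3)
  have e5 := hc 96000 (sigSer 3 ^ 3)
  have e6 := hc 1764 (sigSer 5 ^ 2)
  push_cast at e1 e2 e3 e4 e5 e6
  rw [map_sub, map_add, map_sub, map_add, e1, e2, e3, e4, e5, e6] at h
  obtain ⟨c, hcc⟩ := cube_coeff (sigSer 3) n hn
  rw [hcc] at h
  simp only [tauSer, sigSer, PowerSeries.coeff_mk] at h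
  have hs : (9 : ℤ) ∣ 10 * (ArithmeticFunction.sigma 7 n : ℤ) + 7 * (ArithmeticFunction.sigma 5 n : ℤ)
      - 5 * (ArithmeticFunction.sigma 3 n : ℤ) - 12 * (ArithmeticFunction.sigma 1 n : ℤ) := by
    simp only [ArithmeticFunction.sigma_apply]
    push_cast
    simp only [Finset.mul_sum]
    rw [← Finset.sum_add_distrib, ← Finset.sum_sub_distrib, ← Finset.sum_sub_distrib]
    apply Finset.dvd_sum
    intro d hd
    have hd3 : ¬ 3 ∣ d := fun h => hn (h.trans (Nat.dvd_of_mem_divisors hd))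
    refine (ZMod.intCast_zmod_eq_zero_iff_dvd _ 9).mp ?_
    push_cast
    have hd9 : (d : ZMod 9) = ((d % 9 : ℕ) : ZMod 9) := by simp
    rw [hd9]
    have : d % 9 < 9 := Nat.mod_lt _ (by norm_num)
    have h4 : ¬ 3 ∣ d % 9 := by omega
    generalize d % 9 = r at *
    interval_cases r <;> first | (exfalso; omega) | rfl
  obtain ⟨w, hw⟩ := hs
  omega

lemma tau_three (n : ℕ) (hn : 3 ∣ n) : (3 : ℤ) ∣ ramanujanTau n := by
  have : Fact (Nat.Prime 3) := ⟨Nat.prime_three⟩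
  have hk : ∀ k : ℕ, ((1 : Polynomial (ZMod 3)) - Polynomial.X ^ k) ^ 24 =
      Polynomial.expand (ZMod 3) 3 (((1 : Polynomial (ZMod 3)) - Polynomial.X ^ k) ^ 8) := by
    intro k
    have h1 : ((1 : Polynomial (ZMod 3)) - Polynomial.X ^ k) ^ 3 = 1 - (Polynomial.X ^ 3) ^ k := by
      rw [sub_pow_char, one_pow, ← pow_mul, ← pow_mul, mul_comm]
    rw [map_pow, map_sub, map_one, map_pow, Polynomial.expand_X, ← h1, ← pow_mul]
  have hP : (Polynomial.X * ∏ k ∈ Finset.Icc 1 n,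
      ((1 : Polynomial ℤ) - Polynomial.X ^ k) ^ 24).map (Int.castRingHom (ZMod 3)) =
      Polynomial.X * Polynomial.expand (ZMod 3) 3
        (∏ k ∈ Finset.Icc 1 n, ((1 : Polynomial (ZMod 3)) - Polynomial.X ^ k) ^ 8) := by
    rw [Polynomial.map_mul, Polynomial.map_X, Polynomial.map_prod, map_prod]
    simp only [Polynomial.map_pow, Polynomial.map_sub, Polynomial.map_one, Polynomial.map_X, hk]
  have h3 : ((ramanujanTau n : ℤ) : ZMod 3) = 0 := by
    rw [ramanujanTau]
    refine (Polynomial.coeff_map (Int.castRingHom (ZMod 3)) n).symm.trans ?_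
    rw [hP]
    generalize (∏ k ∈ Finset.Icc 1 n, ((1 : Polynomial (ZMod 3)) - Polynomial.X ^ k) ^ 8) = Q
    rcases n with _ | m
    · rw [Polynomial.mul_coeff_zero, Polynomial.coeff_X_zero, zero_mul]
    · rw [Polynomial.coeff_X_mul, Polynomial.coeff_expand (by norm_num), if_neg (by omega)]
  exact (ZMod.intCast_zmod_eq_zero_iff_dvd _ 3).mp h3

/-- `3 ∤ τ(n)` iff `3 ∤ n` and `3 ∤ σ(n)`. -/
lemma tau_iff (n : ℕ) :
    (3 : ℤ) ∣ ramanujanTau n ↔ (3 ∣ n ∨ 3 ∣ ArithmeticFunction.sigma 1 n) := by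
  by_cases hn : 3 ∣ n
  · simp [hn, tau_three n hn]
  · have := tau_mod n hn
    simp only [hn, false_or]
    omega
end PartB

section PartC
open Nat (Primes)

noncomputable def fT (s : ℝ) (n : ℕ) : ℝ := t3 n / (n : ℝ) ^ s

lemma t3_eq (n : ℕ) :
    t3 n = if (3 ∣ n ∨ 3 ∣ ArithmeticFunction.sigma 1 n) then 0 else 1 := by
  unfold t3
  simp only [tau_iff]

lemma t3_mul {m n : ℕ} (h : m.Coprime n) : t3 (m * n) = t3 m * t3 n := by
  have h3 := Nat.prime_three
  simp only [t3_eq, ArithmeticFunction.isMultiplicative_sigma.map_mul_of_coprime h,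
    h3.dvd_mul]
  split_ifs <;> first | (exfalso; tauto) | simp

lemma t3_abs (n : ℕ) : |t3 n| ≤ 1 := by
  unfold t3; split_ifs <;> simp

lemma fT_summable {s : ℝ} (hs : 1 < s) : Summable (fun n => ‖fT s n‖) := by
  refine Summable.of_nonneg_of_le (fun _ => norm_nonneg _) (fun n => ?_)
    (Real.summable_one_div_nat_rpow.mpr hs)
  have h : 0 ≤ (n : ℝ) ^ s := by positivity
  rw [fT, Real.norm_eq_abs, abs_div, abs_of_nonneg h]
  gcongr
  exact t3_abs n

lemma fT_zero (s : ℝ) : fT s 0 = 0 := by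
  simp [fT, t3_eq]

lemma fT_one (s : ℝ) : fT s 1 = 1 := by
  simp [fT, t3_eq]

lemma fT_mul (s : ℝ) {m n : ℕ} (h : m.Coprime n) : fT s (m * n) = fT s m * fT s n := by
  rw [fT, fT, fT, t3_mul h, Nat.cast_mul, Real.mul_rpow (by positivity) (by positivity)]
  ring

lemma fT_hasProd {s : ℝ} (hs : 1 < s) :
    HasProd (fun p : Primes => ∑' e, fT s (p ^ e)) (∑' n : ℕ, t3 (n + 1) / ((n : ℝ) + 1) ^ s) := by
  have h := EulerProduct.eulerProduct_hasProd (fT_one s) (fT_mul s) (fT_summable hs) (fT_zero s)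
  rw [(fT_summable hs).of_norm.tsum_eq_zero_add, fT_zero, zero_add] at h
  simpa [fT] using h

lemma fT_pow (s : ℝ) (p e : ℕ) : fT s (p ^ e) = t3 (p ^ e) * ((p : ℝ) ^ (-s)) ^ e := by
  rw [fT, Real.rpow_neg (by positivity), inv_pow, div_eq_mul_inv, Nat.cast_pow,
    ← Real.rpow_natCast, ← Real.rpow_natCast, ← Real.rpow_mul (by positivity),
    ← Real.rpow_mul (by positivity), mul_comm s]

lemma sigma_zmod (p e : ℕ) (hp : p.Prime) :
    3 ∣ ArithmeticFunction.sigma 1 (p ^ e) ↔ ∑ k ∈ Finset.range (e + 1), (p : ZMod 3) ^ k = 0 := by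
  rw [ArithmeticFunction.sigma_one_apply_prime_pow hp, ← CharP.cast_eq_zero_iff (ZMod 3) 3]
  push_cast
  rfl

lemma castmod (p : ℕ) : (p : ZMod 3) = ((p % 3 : ℕ) : ZMod 3) := by simp

lemma x_bounds {s : ℝ} (hs : 1 < s) {p : ℕ} (hp : p.Prime) :
    0 < (p : ℝ) ^ (-s) ∧ (p : ℝ) ^ (-s) < 1 := by
  have h1 : (1 : ℝ) < p := by exact_mod_cast hp.one_lt
  exact ⟨Real.rpow_pos_of_pos (by linarith) _, Real.rpow_lt_one_of_one_lt_of_neg h1 (by linarith)⟩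

lemma local_one {s : ℝ} (hs : 1 < s) {p : ℕ} (hp : p.Prime) (h : p % 3 = 1) :
    ∑' e, fT s (p ^ e) = (1 + (p : ℝ) ^ (-s)) / (1 - ((p : ℝ) ^ (-s)) ^ 3) := by
  obtain ⟨hx0, hx1⟩ := x_bounds hs hp
  simp only [fT_pow]
  have ht : ∀ e, t3 (p ^ e) = if 3 ∣ e + 1 then 0 else 1 := by
    intro e
    rw [t3_eq]
    have h1 : ¬ 3 ∣ p ^ e := fun hd => by
      have := Nat.prime_three.dvd_of_dvd_pow hd
      omega
    have h2 : ∑ k ∈ Finset.range (e + 1), ((1 : ℕ) : ZMod 3) ^ k = ((e + 1 : ℕ) : ZMod 3) := by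
      simp
    have h4 : 3 ∣ ArithmeticFunction.sigma 1 (p ^ e) ↔ 3 ∣ e + 1 := by
      rw [sigma_zmod p e hp, castmod p, h, h2, CharP.cast_eq_zero_iff (ZMod 3) 3]
    simp only [h1, false_or, h4]
  simp only [ht]
  generalize (p : ℝ) ^ (-s) = x at *
  have hx3 : x ^ 3 < 1 := pow_lt_one₀ hx0.le hx1 (by norm_num)
  have g1 := hasSum_geometric_of_lt_one hx0.le hx1
  have g2 := (hasSum_geometric_of_lt_one (pow_nonneg hx0.le 3) hx3).mul_left (x ^ 2)
  have g3 : HasSum (fun e : ℕ => if 3 ∣ e + 1 then x ^ e else 0) (x ^ 2 * (1 - x ^ 3)⁻¹) := by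
    have hinj : Function.Injective (fun k : ℕ => 3 * k + 2) := fun a b hab => by
      simp at hab; exact hab
    refine (hinj.hasSum_iff ?_).mp ?_
    · intro e he
      rw [if_neg]
      intro ⟨k, hk⟩
      exact he ⟨k - 1, by simp; omega⟩
    · have hk : ((fun e : ℕ => if 3 ∣ e + 1 then x ^ e else 0) ∘ fun k : ℕ => 3 * k + 2) =
          fun i => x ^ 2 * (x ^ 3) ^ i := by
        funext k
        change (if 3 ∣ 3 * k + 2 + 1 then x ^ (3 * k + 2) else 0) = _
        rw [if_pos (by omega)]
        ring
      rw [hk]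
      exact g2
  have g4 := g1.sub g3
  have : (fun e : ℕ => (if 3 ∣ e + 1 then (0 : ℝ) else 1) * x ^ e) =
      fun e => x ^ e - if 3 ∣ e + 1 then x ^ e else 0 := by
    ext e; split_ifs <;> simp
  rw [this, g4.tsum_eq]
  have a1 : 1 - x ≠ 0 := by linarith
  have a2 : 1 - x ^ 3 ≠ 0 := by linarith
  field_simp
  ring

lemma local_two {s : ℝ} (hs : 1 < s) {p : ℕ} (hp : p.Prime) (h : p % 3 = 2) :
    ∑' e, fT s (p ^ e) = (1 - ((p : ℝ) ^ (-s)) ^ 2)⁻¹ := by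
  obtain ⟨hx0, hx1⟩ := x_bounds hs hp
  simp only [fT_pow]
  have ht : ∀ e, t3 (p ^ e) = if Even e then 1 else 0 := by
    intro e
    rw [t3_eq]
    have h1 : ¬ 3 ∣ p ^ e := fun hd => by
      have := Nat.prime_three.dvd_of_dvd_pow hd
      omega
    have h2 : ((2 : ℕ) : ZMod 3) = -1 := by decide
    have h4 : 3 ∣ ArithmeticFunction.sigma 1 (p ^ e) ↔ ¬ Even e := by
      rw [sigma_zmod p e hp, castmod p, h, h2, neg_one_geom_sum]
      by_cases he : Even e <;> simp [he, Nat.even_add_one]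
    simp only [h1, false_or, h4]
    by_cases he : Even e <;> simp [he]
  simp only [ht]
  generalize (p : ℝ) ^ (-s) = x at *
  have hx2 : x ^ 2 < 1 := pow_lt_one₀ hx0.le hx1 (by norm_num)
  have g2 := (hasSum_geometric_of_lt_one (pow_nonneg hx0.le 2) hx2)
  have hinj : Function.Injective (fun k : ℕ => 2 * k) := fun a b hab => by
      simp at hab; exact hab
  refine ((hinj.hasSum_iff ?_).mp ?_).tsum_eq
  · intro e he
    rw [if_neg, zero_mul]
    intro ⟨k, hk⟩
    exact he ⟨k, by simp; omega⟩
  · convert g2 using 2 with k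
    simp [pow_mul]

lemma local_three (s : ℝ) : ∑' e, fT s (3 ^ e) = 1 := by
  rw [tsum_eq_single 0]
  · simp [fT_one]
  · intro e he
    have : 3 ∣ 3 ^ e := dvd_pow_self 3 he
    simp [fT, t3_eq, this]

lemma summ_sub {r : ℝ} (hr : 1 < r) (Q : ℕ → Prop) :
    Summable (fun p : {p : ℕ // Q p} => (p.1 : ℝ) ^ (-r)) :=
  (Real.summable_nat_rpow.mpr (by linarith)).comp_injective Subtype.val_injective

lemma mult_sub_s15 {r : ℝ} (hr : 1 < r) (Q : ℕ → Prop) :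
    Multipliable (fun p : {p : ℕ // Q p} => (1 - (p.1 : ℝ) ^ (-r))) := by
  have := multipliable_one_add_of_summable (f := fun p : {p : ℕ // Q p} => - (p.1 : ℝ) ^ (-r))
    (by simpa using (summ_sub hr Q).norm)
  simpa [sub_eq_add_neg] using this

lemma mult_sub_inv {r : ℝ} (hr : 1 < r) (Q : ℕ → Prop) (hQ : ∀ p, Q p → p.Prime) :
    Multipliable (fun p : {p : ℕ // Q p} => (1 - (p.1 : ℝ) ^ (-r))⁻¹) := by
  have key : ∀ p : {p : ℕ // Q p}, 0 < (p.1 : ℝ) ^ (-r) ∧ (p.1 : ℝ) ^ (-r) ≤ 1 / 2 := by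
    intro p
    have h2 : (2 : ℝ) ≤ p.1 := by exact_mod_cast (hQ p.1 p.2).two_le
    refine ⟨Real.rpow_pos_of_pos (by linarith) _, ?_⟩
    rw [Real.rpow_neg (by linarith), ← one_div]
    apply one_div_le_one_div_of_le (by norm_num)
    calc (2 : ℝ) ≤ p.1 := h2
      _ = (p.1 : ℝ) ^ (1 : ℝ) := (Real.rpow_one _).symm
      _ ≤ _ := Real.rpow_le_rpow_of_exponent_le (by linarith) hr.le
  have := multipliable_one_add_of_summable
    (f := fun p : {p : ℕ // Q p} => (p.1 : ℝ) ^ (-r) / (1 - (p.1 : ℝ) ^ (-r))) ?_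
  · refine this.congr fun p => ?_
    obtain ⟨h0, h1⟩ := key p
    have : 1 - (p.1 : ℝ) ^ (-r) ≠ 0 := by linarith
    field_simp
    ring
  · refine Summable.of_nonneg_of_le (fun _ => norm_nonneg _) (fun p => ?_)
      ((summ_sub hr Q).mul_left 2)
    obtain ⟨h0, h1⟩ := key p
    have h3 : 0 < 1 - (p.1 : ℝ) ^ (-r) := by linarith
    rw [Real.norm_eq_abs, abs_of_nonneg (by positivity), div_le_iff₀ h3]
    nlinarith

lemma lift_prod (c : ℕ) (g : ℕ → ℝ)
    (h : Multipliable (fun p : {p : ℕ // p.Prime ∧ p % 3 = c} => g p.1)) :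
    HasProd (fun p : Primes => ((if (p : ℕ) % 3 = c then g p else 1 : ℝ) : ℂ))
      ((∏' p : {p : ℕ // p.Prime ∧ p % 3 = c}, g p.1 : ℝ) : ℂ) := by
  have h1 : HasProd (fun p : Primes => (if (p : ℕ) % 3 = c then g p else 1 : ℝ))
      (∏' p : {p : ℕ // p.Prime ∧ p % 3 = c}, g p.1) := by
    have hinj : Function.Injective
        (fun p : {p : ℕ // p.Prime ∧ p % 3 = c} => (⟨p.1, p.2.1⟩ : Primes)) := by
      intro a b hab
      exact Subtype.ext (congrArg (fun q : Primes => (q : ℕ)) hab)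
    refine (hinj.hasProd_iff ?_).mp ?_
    · intro p hp
      rw [if_neg]
      intro h3
      exact hp ⟨⟨p.1, p.2, h3⟩, rfl⟩
    · convert h.hasProd using 2 with p
      exact if_pos p.2.2
  exact h1.map Complex.ofRealHom Complex.continuous_ofReal

lemma chi_val (χ : DirichletCharacter ℂ 3)
    (hχ : ∀ a : ℤ, χ (a : ZMod 3) = (legendreSym 3 a : ℂ)) (p : ℕ) :
    χ (p : ZMod 3) = if p % 3 = 1 then 1 else if p % 3 = 2 then -1 else 0 := by
  have h := hχ ((p % 3 : ℕ) : ℤ)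
  rw [Int.cast_natCast, ← castmod] at h
  rw [h]
  have : p % 3 < 3 := Nat.mod_lt _ (by norm_num)
  generalize p % 3 = r at *
  interval_cases r
  · simp [legendreSym]
  · simp
  · have : legendreSym 3 ((2 : ℕ) : ℤ) = -1 := by decide
    rw [this]; simp

end PartC
lemma local_eq (s : ℝ) (hs : 1 < s) (χ : DirichletCharacter ℂ 3)
    (hχ : ∀ a : ℤ, χ (a : ZMod 3) = (legendreSym 3 a : ℂ)) (p : Nat.Primes) :
    ((∑' e, fT s (p ^ e) : ℝ) : ℂ) * ((∑' e, fT s (p ^ e) : ℝ) : ℂ) =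
    (1 - (p : ℂ) ^ (-(s : ℂ)))⁻¹ * (1 - χ p * (p : ℂ) ^ (-(s : ℂ)))⁻¹ *
      (if (p : ℕ) = 3 then (1 - (3 : ℂ) ^ (-(s : ℂ))) else 1) *
      ((if (p : ℕ) % 3 = 2 then (1 - (p : ℝ) ^ (-(2 * s)))⁻¹ else 1 : ℝ) : ℂ) *
      ((if (p : ℕ) % 3 = 1 then
        ((1 - (p : ℝ) ^ (-(2 * s))) / (1 - (p : ℝ) ^ (-(3 * s)))) ^ 2 else 1 : ℝ) : ℂ) := by
  obtain ⟨p, hp⟩ := p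
  obtain ⟨hx0, hx1⟩ := x_bounds hs hp
  have e1 : (p : ℂ) ^ (-(s : ℂ)) = (((p : ℝ) ^ (-s) : ℝ) : ℂ) := by
    rw [Complex.ofReal_cpow (by positivity)]; simp
  have e2 : (p : ℝ) ^ (-(2 * s)) = ((p : ℝ) ^ (-s)) ^ 2 := by
    rw [← Real.rpow_natCast, ← Real.rpow_mul (by positivity)]; congr 1; push_cast; ring
  have e3 : (p : ℝ) ^ (-(3 * s)) = ((p : ℝ) ^ (-s)) ^ 3 := by
    rw [← Real.rpow_natCast, ← Real.rpow_mul (by positivity)]; congr 1; push_cast; ring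
  have hx2 : ((p : ℝ) ^ (-s)) ^ 2 < 1 := pow_lt_one₀ hx0.le hx1 (by norm_num)
  have hx3 : ((p : ℝ) ^ (-s)) ^ 3 < 1 := pow_lt_one₀ hx0.le hx1 (by norm_num)
  simp only [e1, e2, e3, chi_val χ hχ p]
  have hr : p % 3 = 0 ∨ p % 3 = 1 ∨ p % 3 = 2 := by omega
  rcases hr with hr | hr | hr
  · have : p = 3 := ((Nat.prime_dvd_prime_iff_eq Nat.prime_three hp).mp
      (Nat.dvd_of_mod_eq_zero hr)).symm
    subst this
    rw [local_three]
    have e4 : (3 : ℂ) ^ (-(s : ℂ)) = ((((3 : ℕ) : ℝ) ^ (-s) : ℝ) : ℂ) := by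
      rw [← e1]; norm_num
    rw [e4]
    generalize ((3 : ℕ) : ℝ) ^ (-s) = x at *
    have : (1 : ℂ) - x ≠ 0 := by
      norm_cast
      linarith
    simp [this]
  · have hp3 : p ≠ 3 := by rintro rfl; omega
    rw [local_one hs hp hr]
    generalize (p : ℝ) ^ (-s) = x at *
    simp only [hr, hp3, if_true, if_false, one_mul, mul_one, OfNat.one_ne_ofNat, Complex.ofReal_one]
    norm_cast
    have a1 : 1 - x ≠ 0 := by linarith
    have a3 : 1 - x ^ 3 ≠ 0 := by linarith
    field_simp
    ring
  · have hp3 : p ≠ 3 := by rintro rfl; omega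
    rw [local_two hs hp hr]
    generalize (p : ℝ) ^ (-s) = x at *
    simp only [hr, hp3, if_true, if_false, one_mul, mul_one, OfNat.ofNat_ne_one, Complex.ofReal_one,
      neg_mul, sub_neg_eq_add]
    norm_cast
    have a1 : 1 - x ≠ 0 := by linarith
    have a2 : 1 + x ≠ 0 := by linarith
    have a3 : 1 - x ^ 2 ≠ 0 := by linarith
    have : 1 - x ^ 2 = (1 - x) * (1 + x) := by ring
    rw [this]
    field_simp

/-- `T(s)² = ζ(s) L(s,χ₋₃) (1-3^{-s}) ∏_{p≡2(3)} (1-p^{-2s})⁻¹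
∏_{p≡1(3)} ((1-p^{-2s})/(1-p^{-3s}))²`, where `χ₋₃` is the quadratic character mod 3
(Kronecker character of `ℚ(√-3)`). -/
theorem T_three_square (s : ℝ) (hs : 1 < s)
    (χ : DirichletCharacter ℂ 3)
    (hχ : ∀ a : ℤ, χ (a : ZMod 3) = (legendreSym 3 a : ℂ)) :
    (((∑' n : ℕ, t3 (n + 1) / ((n : ℝ) + 1) ^ s : ℝ) : ℂ)) ^ 2
      = riemannZeta s * DirichletCharacter.LFunction χ s * (1 - (3 : ℂ) ^ (-(s : ℂ)))
        * ((∏' p : {p : ℕ // p.Prime ∧ p % 3 = 2},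
              (1 - (p.1 : ℝ) ^ (-(2 * s)))⁻¹ : ℝ) : ℂ)
        * ((∏' p : {p : ℕ // p.Prime ∧ p % 3 = 1},
              ((1 - (p.1 : ℝ) ^ (-(2 * s))) / (1 - (p.1 : ℝ) ^ (-(3 * s)))) ^ 2 : ℝ) : ℂ) := by
  have hsC : 1 < (s : ℂ).re := by simpa using hs
  have hT0 : HasProd (fun p : Nat.Primes => ((∑' e, fT s (p ^ e) : ℝ) : ℂ))
      ((∑' n : ℕ, t3 (n + 1) / ((n : ℝ) + 1) ^ s : ℝ) : ℂ) :=
    (fT_hasProd hs).map Complex.ofRealHom Complex.continuous_ofReal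
  have hT := hT0.mul hT0
  rw [← pow_two] at hT
  have hZ := riemannZeta_eulerProduct_hasProd hsC
  have hL := DirichletCharacter.LSeries_eulerProduct_hasProd χ hsC
  rw [← DirichletCharacter.LFunction_eq_LSeries χ hsC] at hL
  have h3 : HasProd (fun p : Nat.Primes => if (p : ℕ) = 3 then
      (1 - (3 : ℂ) ^ (-(s : ℂ))) else 1) (1 - (3 : ℂ) ^ (-(s : ℂ))) := by
    have h := hasProd_single (f := fun p : Nat.Primes => if (p : ℕ) = 3 then
      (1 - (3 : ℂ) ^ (-(s : ℂ))) else 1) ⟨3, Nat.prime_three⟩ (fun p hp => if_neg fun h =>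
        hp (Subtype.ext h))
    simpa using h
  have hA := lift_prod 2 (fun p => (1 - (p : ℝ) ^ (-(2 * s)))⁻¹)
    (mult_sub_inv (by linarith) _ fun p hp => hp.1)
  have hm : Multipliable (fun p : {p : ℕ // p.Prime ∧ p % 3 = 1} =>
      ((1 - (p.1 : ℝ) ^ (-(2 * s))) / (1 - (p.1 : ℝ) ^ (-(3 * s)))) ^ 2) := by
    have := (mult_sub_s15 (r := 2 * s) (by linarith) (fun p => p.Prime ∧ p % 3 = 1)).mul
      (mult_sub_inv (r := 3 * s) (by linarith) (fun p => p.Prime ∧ p % 3 = 1) fun p hp => hp.1)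
    refine (this.mul this).congr fun p => ?_
    ring
  have hB := lift_prod 1
    (fun p => ((1 - (p : ℝ) ^ (-(2 * s))) / (1 - (p : ℝ) ^ (-(3 * s)))) ^ 2) hm
  have hR := (((hZ.mul hL).mul h3).mul hA).mul hB
  have hfun : (fun p : Nat.Primes => ((∑' e, fT s (p ^ e) : ℝ) : ℂ) * ((∑' e, fT s (p ^ e) : ℝ) : ℂ))
      = _ := funext (local_eq s hs χ hχ)
  rw [hfun] at hT
  exact hT.unique hR
end
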